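/- arXiv:2002.05118 — 7 statements merged into one kernel-verified Lean document; each statement's English description precedes it below -/
import Mathlib

section
/- For every natural number n ≥ 1, the polynomial p_n(x) = (n!/(2n)!) · dⁿ/dxⁿ[(x²−1)ⁿ] has exactly n zeros x_1, …, x_n, which are real, pairwise distinct, and all contained in the open interval (−1, 1), so that p_n(x) = ∏_{i=1}^{n} (x − x_i). -/
open Polynomial

/-- The monic Legendre polynomial, given by Rodrigues' formula normalized to be monic:
`p_n(x) = (n!/(2n)!) · dⁿ/dxⁿ[(x²−1)ⁿ]`. -/
noncomputable def legendreMonic (n : ℕ) : Polynomial ℝ :=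
  Polynomial.C ((n.factorial : ℝ) / ((2 * n).factorial : ℝ)) *
    Polynomial.derivative^[n] ((Polynomial.X ^ 2 - 1) ^ n)

theorem Polynomial.exists_roots_derivative_between (p : ℝ[X]) {m : ℕ} {y : Fin (m + 1) → ℝ}
    (hy : StrictMono y) (hp : ∀ i, p.eval (y i) = 0) :
    ∃ z : Fin m → ℝ, StrictMono z ∧
      ∀ i, z i ∈ Set.Ioo (y i.castSucc) (y i.succ) ∧ p.derivative.eval (z i) = 0 := by
  have rolle (i : Fin m) :
      ∃ z ∈ Set.Ioo (y i.castSucc) (y i.succ), p.derivative.eval z = 0 := by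
    obtain ⟨z, hz, hpz⟩ := exists_deriv_eq_zero (hy i.castSucc_lt_succ)
      p.continuous.continuousOn ((hp _).trans (hp _).symm)
    exact ⟨z, hz, by rwa [Polynomial.deriv] at hpz⟩
  choose z hz hpz using rolle
  refine ⟨z, fun i j hij => ?_, fun i => ⟨hz i, hpz i⟩⟩
  exact ((hz i).2.trans_le (hy.monotone (Fin.succ_le_castSucc_iff.2 hij))).trans (hz j).1

theorem eval_iterate_derivative_X_sq_sub_one_pow_eq_zero {n k : ℕ} (hk : k < n) {a : ℝ}
    (ha : a ^ 2 = 1) : (derivative^[k] ((X ^ 2 - 1 : ℝ[X]) ^ n)).eval a = 0 := by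
  have hroot : X - C a ∣ (X ^ 2 - 1 : ℝ[X]) := by
    rw [dvd_iff_isRoot]
    simp [ha]
  have hpow := pow_sub_dvd_iterate_derivative_of_pow_dvd k (pow_dvd_pow_of_dvd hroot n)
  exact dvd_iff_isRoot.1 ((dvd_pow_self _ (Nat.sub_ne_zero_of_lt hk)).trans hpow)

theorem exists_strictMono_roots_iterate_derivative_X_sq_sub_one_pow {n k : ℕ} (hk : k ≤ n) :
    ∃ x : Fin k → ℝ, StrictMono x ∧ ∀ i, x i ∈ Set.Ioo (-1 : ℝ) 1 ∧
      (derivative^[k] ((X ^ 2 - 1 : ℝ[X]) ^ n)).eval (x i) = 0 := by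
  induction k with
  | zero => exact ⟨Fin.elim0, fun i => i.elim0, fun i => i.elim0⟩
  | succ k ih =>
    obtain ⟨x, hx, hroot⟩ := ih (by omega)
    let s : Finset ℝ := insert (-1) (insert 1 (Finset.univ.image x))
    have hs : s.card = k + 1 + 1 := by
      rw [Finset.card_insert_of_notMem, Finset.card_insert_of_notMem,
        Finset.card_image_of_injective _ hx.injective, Finset.card_fin]
      · simp only [Finset.mem_image, Finset.mem_univ, true_and, not_exists]
        exact fun i => (hroot i).1.2.ne
      · simp only [Finset.mem_insert, Finset.mem_image, Finset.mem_univ, true_and, not_or,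
          not_exists]
        exact ⟨by norm_num, fun i => (hroot i).1.1.ne'⟩
    have hmem (a : ℝ) (ha : a ∈ s) : a ∈ Set.Icc (-1 : ℝ) 1 ∧
        (derivative^[k] ((X ^ 2 - 1 : ℝ[X]) ^ n)).eval a = 0 := by
      simp only [s, Finset.mem_insert, Finset.mem_image, Finset.mem_univ, true_and] at ha
      obtain rfl | rfl | ⟨i, rfl⟩ := ha
      · exact ⟨by norm_num, eval_iterate_derivative_X_sq_sub_one_pow_eq_zero hk (by norm_num)⟩
      · exact ⟨by norm_num, eval_iterate_derivative_X_sq_sub_one_pow_eq_zero hk (by norm_num)⟩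
      · exact ⟨Set.Ioo_subset_Icc_self (hroot i).1, (hroot i).2⟩
    have hy (i) := hmem _ (s.orderEmbOfFin_mem hs i)
    obtain ⟨z, hz, hz'⟩ := exists_roots_derivative_between _
      (s.orderEmbOfFin hs).strictMono fun i => (hy i).2
    refine ⟨z, hz, fun i => ⟨⟨(hy _).1.1.trans_lt (hz' i).1.1,
      (hz' i).1.2.trans_le (hy _).1.2⟩, ?_⟩⟩
    rw [Function.iterate_succ_apply']
    exact (hz' i).2

theorem natDegree_X_sq_sub_one_pow (n : ℕ) : ((X ^ 2 - 1 : ℝ[X]) ^ n).natDegree = 2 * n := by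
  rw [natDegree_pow, ← C_1, natDegree_X_pow_sub_C, mul_comm]

theorem natDegree_legendreMonic_le (n : ℕ) : (legendreMonic n).natDegree ≤ n := by
  refine (natDegree_C_mul_le _ _).trans ((natDegree_iterate_derivative _ _).trans ?_)
  rw [natDegree_X_sq_sub_one_pow]
  omega

theorem coeff_legendreMonic_self (n : ℕ) : (legendreMonic n).coeff n = 1 := by
  have hmonic : ((X ^ 2 - 1 : ℝ[X]) ^ n).Monic := by
    rw [← C_1]
    exact (monic_X_pow_sub_C _ two_ne_zero).pow n
  have hlead : ((X ^ 2 - 1 : ℝ[X]) ^ n).coeff (2 * n) = 1 := by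
    rw [← natDegree_X_sq_sub_one_pow n]
    exact hmonic
  have hfact : (n.factorial : ℝ) * (2 * n).descFactorial n = (2 * n).factorial := by
    have h := Nat.factorial_mul_descFactorial (show n ≤ 2 * n by omega)
    rw [show 2 * n - n = n by omega] at h
    exact_mod_cast h
  rw [legendreMonic, coeff_C_mul, coeff_iterate_derivative, ← two_mul, hlead, nsmul_one,
    div_mul_eq_mul_div, hfact, div_self (Nat.cast_ne_zero.2 (Nat.factorial_ne_zero _))]

theorem monic_legendreMonic (n : ℕ) : (legendreMonic n).Monic :=
  monic_of_natDegree_le_of_coeff_eq_one n (natDegree_legendreMonic_le n)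
    (coeff_legendreMonic_self n)

/-- For every `n ≥ 1`, the polynomial `p_n` has exactly `n` zeros `x_1 < ⋯ < x_n`, which are
real, pairwise distinct, and contained in `(−1, 1)`, and `p_n(x) = ∏ (x − x_i)`. -/
theorem legendreMonic_zeros (n : ℕ) (hn : 1 ≤ n) :
    ∃ x : Fin n → ℝ, StrictMono x ∧ (∀ i, x i ∈ Set.Ioo (-1:ℝ) 1) ∧
      legendreMonic n = ∏ i : Fin n, (Polynomial.X - Polynomial.C (x i)) := by
  obtain ⟨x, hx, hroot⟩ :=
    exists_strictMono_roots_iterate_derivative_X_sq_sub_one_pow (le_refl n)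
  refine ⟨x, hx, fun i => (hroot i).1, ?_⟩
  have hdvd : ∏ i : Fin n, (X - C (x i)) ∣ legendreMonic n := by
    refine Finset.prod_dvd_of_coprime
      (fun i _ j _ hij => pairwise_coprime_X_sub_C hx.injective hij) fun i _ => ?_
    rw [dvd_iff_isRoot, IsRoot, legendreMonic, eval_mul, (hroot i).2, mul_zero]
  refine eq_of_monic_of_dvd_of_natDegree_le (monic_prod_X_sub_C x _)
    (monic_legendreMonic n) hdvd ?_
  rw [natDegree_finsetProd_X_sub_C_eq_card, Finset.card_fin]
  exact natDegree_legendreMonic_le n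
end

section
/- For every natural number n ≥ 1, the monic Legendre polynomials satisfy ∫_{−1}^{1} p_n(x)² dx = (1/4) · ((2n)² / ((2n−1)(2n+1))) · ∫_{−1}^{1} p_{n−1}(x)² dx, and consequently ∫_{−1}^{1} p_n(x)² dx ≤ 2^{−2n} π. -/
open Polynomial

open intervalIntegral in
theorem Polynomial.integral_derivative_eval (p : ℝ[X]) (a b : ℝ) :
    ∫ x in a..b, (derivative p).eval x = p.eval b - p.eval a :=
  integral_eq_sub_of_hasDerivAt (fun x _ => p.hasDerivAt x)
    ((derivative p).continuous.intervalIntegrable a b)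

theorem Polynomial.integral_derivative_mul_eval (p q : ℝ[X]) {a b : ℝ}
    (ha : p.eval a = 0) (hb : p.eval b = 0) :
    ∫ x in a..b, (derivative p * q).eval x = -∫ x in a..b, (p * derivative q).eval x := by
  have h := integral_derivative_eval (p * q) a b
  simp only [derivative_mul, eval_add (p := derivative p * q)] at h
  rw [intervalIntegral.integral_add
    ((derivative p * q).continuous.intervalIntegrable a b)
    ((p * derivative q).continuous.intervalIntegrable a b)] at h
  rw [eval_mul, eval_mul, ha, hb, zero_mul, zero_mul, sub_zero] at h
  linarith

theorem Polynomial.eval_iterate_derivative_pow_eq_zero {R : Type*} [CommRing R] {w : R[X]} {c : R}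
    (hc : w.eval c = 0) {n k : ℕ} (hk : k < n) : (derivative^[k] (w ^ n)).eval c = 0 := by
  obtain ⟨r, hr⟩ := pow_sub_dvd_iterate_derivative_pow w n k
  rw [hr, eval_mul, eval_pow, hc, zero_pow (Nat.sub_ne_zero_of_lt hk), zero_mul]

/-- Iterated integration by parts against a power vanishing at both endpoints. -/
theorem Polynomial.integral_iterate_derivative_pow_mul_eval {w : ℝ[X]} {a b : ℝ}
    (ha : w.eval a = 0) (hb : w.eval b = 0) (n : ℕ) {k : ℕ} (hk : k ≤ n) (q : ℝ[X]) :
    ∫ x in a..b, (derivative^[k] (w ^ n) * q).eval x =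
      (-1) ^ k * ∫ x in a..b, (w ^ n * derivative^[k] q).eval x := by
  induction k generalizing q with
  | zero => simp
  | succ k ih =>
    rw [Function.iterate_succ_apply', integral_derivative_mul_eval _ _
      (eval_iterate_derivative_pow_eq_zero ha hk) (eval_iterate_derivative_pow_eq_zero hb hk),
      ih (by omega), Function.iterate_succ_apply]
    ring

theorem Polynomial.Monic.iterate_derivative_natDegree {R : Type*} [CommSemiring R] {p : R[X]}
    (hp : p.Monic) : derivative^[p.natDegree] p = C (p.natDegree.factorial : R) := by
  have h := natDegree_iterate_derivative p p.natDegree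
  rw [Nat.sub_self, Nat.le_zero] at h
  rw [eq_C_of_natDegree_eq_zero h, coeff_iterate_derivative, zero_add, hp.coeff_natDegree,
    Nat.descFactorial_self, nsmul_one]

theorem iterate_derivative_X_sq_sub_one_pow (n : ℕ) :
    derivative^[2 * n] ((X ^ 2 - 1 : ℝ[X]) ^ n) = C ((2 * n).factorial : ℝ) := by
  have hm : (X ^ 2 - 1 : ℝ[X]).Monic := by
    simpa using monic_X_pow_sub_C (1 : ℝ) two_ne_zero
  have hd : ((X ^ 2 - 1 : ℝ[X]) ^ n).natDegree = 2 * n := by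
    have : (X ^ 2 - 1 : ℝ[X]).natDegree = 2 := by
      simpa using natDegree_X_pow_sub_C (n := 2) (r := (1 : ℝ))
    rw [hm.natDegree_pow, this, mul_comm]
  simpa only [hd] using (hm.pow n).iterate_derivative_natDegree

theorem integral_legendreMonic_sq (n : ℕ) :
    ∫ x in (-1 : ℝ)..1, (legendreMonic n).eval x ^ 2 =
      (n.factorial : ℝ) ^ 2 / (2 * n).factorial *
        ((-1) ^ n * ∫ x in (-1 : ℝ)..1, ((X ^ 2 - 1 : ℝ[X]) ^ n).eval x) := by
  have h := integral_iterate_derivative_pow_mul_eval (w := X ^ 2 - 1) (a := -1) (b := 1)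
    (by simp) (by simp) n le_rfl (derivative^[n] ((X ^ 2 - 1) ^ n))
  rw [← Function.iterate_add_apply, ← two_mul, iterate_derivative_X_sq_sub_one_pow] at h
  simp only [eval_mul, eval_C, intervalIntegral.integral_mul_const] at h
  have hf : ((2 * n).factorial : ℝ) ≠ 0 := by positivity
  simp only [legendreMonic, eval_mul, eval_C, mul_pow, intervalIntegral.integral_const_mul]
  simp only [sq (eval _ (derivative^[n] _)), h]
  field_simp

theorem integral_X_sq_sub_one_pow_succ (n : ℕ) :
    (2 * n + 3) * ∫ x in (-1 : ℝ)..1, ((X ^ 2 - 1 : ℝ[X]) ^ (n + 1)).eval x =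
      -(2 * n + 2) * ∫ x in (-1 : ℝ)..1, ((X ^ 2 - 1 : ℝ[X]) ^ n).eval x := by
  have h := integral_derivative_eval (X * (X ^ 2 - 1) ^ (n + 1)) (-1) 1
  have hd : derivative (X * (X ^ 2 - 1 : ℝ[X]) ^ (n + 1)) =
      C (2 * n + 3 : ℝ) * (X ^ 2 - 1) ^ (n + 1) + C (2 * n + 2 : ℝ) * (X ^ 2 - 1) ^ n := by
    simp only [derivative_mul, derivative_X, derivative_pow, derivative_sub, derivative_one, map_add,
      map_mul, map_natCast, C_ofNat, Nat.add_sub_cancel]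
    push_cast
    ring
  simp only [hd, eval_add (p := C (2 * n + 3 : ℝ) * _)] at h
  rw [intervalIntegral.integral_add
    (Polynomial.continuous _ |>.intervalIntegrable _ _)
    (Polynomial.continuous _ |>.intervalIntegrable _ _)] at h
  simp only [eval_mul (p := C _), eval_C, intervalIntegral.integral_const_mul] at h
  simp at h ⊢
  linarith

theorem integral_legendreMonic_succ_sq (n : ℕ) :
    ∫ x in (-1 : ℝ)..1, (legendreMonic (n + 1)).eval x ^ 2 =
      (n + 1) ^ 2 / ((2 * n + 1) * (2 * n + 3)) *
        ∫ x in (-1 : ℝ)..1, (legendreMonic n).eval x ^ 2 := by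
  have h := integral_X_sq_sub_one_pow_succ n
  rw [integral_legendreMonic_sq, integral_legendreMonic_sq,
    eq_div_of_mul_eq (by positivity) ((mul_comm _ _).trans h),
    show 2 * (n + 1) = 2 * n + 1 + 1 by ring, Nat.factorial_succ, Nat.factorial_succ,
    Nat.factorial_succ]
  push_cast
  field_simp
  ring

theorem integral_legendreMonic_sq_eq_wallis (n : ℕ) :
    ∫ x in (-1 : ℝ)..1, (legendreMonic n).eval x ^ 2 = 2 / 4 ^ n * Real.Wallis.W n := by
  induction n with
  | zero => norm_num [legendreMonic, Real.Wallis.W]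
  | succ n ih =>
    rw [integral_legendreMonic_succ_sq, ih, Real.Wallis.W_succ]
    field_simp
    ring

/-- For every `n ≥ 1`,
`∫_{−1}^{1} p_n(x)² dx = (1/4)·((2n)²/((2n−1)(2n+1)))·∫_{−1}^{1} p_{n−1}(x)² dx`,
and consequently `∫_{−1}^{1} p_n(x)² dx ≤ 2^{−2n} π`. -/
theorem legendreMonic_sq_integral (n : ℕ) (hn : 1 ≤ n) :
    (∫ x in (-1:ℝ)..1, (legendreMonic n).eval x ^ 2) =
      (1 / 4) * ((2 * (n : ℝ)) ^ 2 / ((2 * (n : ℝ) - 1) * (2 * (n : ℝ) + 1))) *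
        ∫ x in (-1:ℝ)..1, (legendreMonic (n - 1)).eval x ^ 2 ∧
    (∫ x in (-1:ℝ)..1, (legendreMonic n).eval x ^ 2) ≤ (2 : ℝ) ^ (-(2 * (n : ℤ))) * Real.pi := by
  constructor
  · obtain ⟨n, rfl⟩ := Nat.exists_eq_add_of_le' hn
    rw [integral_legendreMonic_succ_sq, Nat.add_sub_cancel]
    push_cast
    rw [show (2 * ((n : ℝ) + 1) - 1) = 2 * n + 1 by ring,
      show (2 * ((n : ℝ) + 1) + 1) = 2 * n + 3 by ring]
    ring
  · have h4 : (2 : ℝ) ^ (-(2 * (n : ℤ))) = 1 / 4 ^ n := by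
      rw [zpow_neg, zpow_mul, zpow_natCast, one_div]
      norm_num
    calc ∫ x in (-1:ℝ)..1, (legendreMonic n).eval x ^ 2
        = 2 / 4 ^ n * Real.Wallis.W n := integral_legendreMonic_sq_eq_wallis n
      _ ≤ 2 / 4 ^ n * (Real.pi / 2) := by gcongr; exact Real.Wallis.W_le n
      _ = _ := by rw [h4]; ring
end

section
/- Scaled Gauss–Legendre quadrature with analytic error bound: for every natural number n ≥ 1 there exist real numbers x_1, …, x_n ∈ (−1,1) (the zeros of the monic Legendre polynomial p_n) and weights w_1, …, w_n such that the following holds. Let a < b be real numbers and let f be a complex-analytic function on the union of the open balls of radius 1 in ℂ centered at the points of the interval [a, b], with |f| bounded by F on this union. Then |∫_a^b f(x) dx − Σ_{i=1}^{n} w_i · ((b−a)/2) · f((a+b)/2 + ((b−a)/2) x_i)| ≤ π · 2^{−2n} · ((b−a)/2)^{2n+1} · F. -/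
open Polynomial

theorem monic_X_sq_sub_one_pow (n : ℕ) : ((X ^ 2 - 1 : ℝ[X]) ^ n).Monic := by
  have := monic_X_pow_sub_C (1 : ℝ) two_ne_zero
  rw [C_1] at this
  exact this.pow n

theorem X_sub_C_pow_dvd_X_sq_sub_one_pow (n : ℕ) {a : ℝ} (ha : a ^ 2 = 1) :
    (X - C a) ^ n ∣ (X ^ 2 - 1 : ℝ[X]) ^ n := by
  refine pow_dvd_pow_of_dvd ?_ n
  rw [dvd_iff_isRoot]
  simp [ha]

theorem natDegree_legendreMonic (n : ℕ) : (legendreMonic n).natDegree = n :=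
  (natDegree_legendreMonic_le n).antisymm
    (le_natDegree_of_ne_zero (by simp [coeff_legendreMonic_self]))

/-- Rolle's theorem applied between consecutive zeros. -/
theorem exists_interlacing_derivative_roots {q : ℝ[X]} {k : ℕ} {z : ℕ → ℝ}
    (hz : ∀ i ≤ k, z i < z (i + 1)) (hq : ∀ i ≤ k + 1, q.eval (z i) = 0) :
    ∃ y : ℕ → ℝ, ∀ i ≤ k, y i ∈ Set.Ioo (z i) (z (i + 1)) ∧ q.derivative.eval (y i) = 0 := by
  have h : ∀ i, ∃ y, i ≤ k → y ∈ Set.Ioo (z i) (z (i + 1)) ∧ q.derivative.eval y = 0 := by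
    intro i
    by_cases hi : i ≤ k
    · obtain ⟨y, hy, hy'⟩ := exists_deriv_eq_zero (hz i hi) q.continuousOn
        ((hq i (by omega)).trans (hq (i + 1) (by omega)).symm)
      exact ⟨y, fun _ => ⟨hy, by rwa [Polynomial.deriv] at hy'⟩⟩
    · exact ⟨0, fun h => absurd h hi⟩
  choose y hy using h
  exact ⟨y, hy⟩

/-- The `k`-th derivative of `(X² - 1)ⁿ`, `k < n`, vanishes at the endpoints `±1` and
at `k` points in between. -/
theorem exists_roots_iterate_derivative (n k : ℕ) (hk : k < n) :
    ∃ z : ℕ → ℝ, z 0 = -1 ∧ z (k + 1) = 1 ∧ (∀ i ≤ k, z i < z (i + 1)) ∧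
      ∀ i ≤ k + 1, (derivative^[k] ((X ^ 2 - 1 : ℝ[X]) ^ n)).eval (z i) = 0 := by
  have hend (j : ℕ) (hj : j < n) {a : ℝ} (ha : a ^ 2 = 1) :
      (derivative^[j] ((X ^ 2 - 1 : ℝ[X]) ^ n)).eval a = 0 := by
    have h := pow_sub_dvd_iterate_derivative_of_pow_dvd j (X_sub_C_pow_dvd_X_sq_sub_one_pow n ha)
    exact dvd_iff_isRoot.1 ((dvd_pow_self _ (by omega)).trans h)
  induction k with
  | zero =>
    refine ⟨fun i => if i = 0 then -1 else 1, by simp, by simp, ?_, ?_⟩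
    · intro i hi
      obtain rfl : i = 0 := by omega
      norm_num
    · intro i _
      refine hend 0 hk ?_
      dsimp only
      split_ifs <;> norm_num
  | succ k ih =>
    obtain ⟨z, hz0, hz1, hz, hzq⟩ := ih (by omega)
    obtain ⟨y, hy⟩ := exists_interlacing_derivative_roots hz hzq
    refine ⟨fun i => if i = 0 then -1 else if i ≤ k + 1 then y (i - 1) else 1, by simp, by simp,
      ?_, ?_⟩
    · intro i hi
      rcases Nat.eq_zero_or_pos i with rfl | hi0
      · simpa [hz0] using (hy 0 (by omega)).1.1
      obtain ⟨j, rfl⟩ : ∃ j, i = j + 1 := ⟨i - 1, by omega⟩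
      have hj := (hy j (by omega)).1
      rcases (show j = k ∨ j < k by omega) with rfl | hjk
      · simpa [hz1] using hj.2
      · have hj' := (hy (j + 1) (by omega)).1
        have h1 : j + 1 ≤ k + 1 := by omega
        have h2 : j + 1 + 1 ≤ k + 1 := by omega
        simpa [hjk.le, Nat.succ_le_of_lt hjk] using hj.2.trans hj'.1
    · intro i hi
      dsimp only
      split_ifs with h0 h1
      · exact hend _ hk (by norm_num)
      · rw [Function.iterate_succ_apply']
        exact (hy (i - 1) (by omega)).2
      · exact hend _ hk (by norm_num)

theorem exists_legendreMonic_roots (n : ℕ) (hn : 1 ≤ n) :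
    ∃ x : Fin n → ℝ, StrictMono x ∧ (∀ i, x i ∈ Set.Ioo (-1 : ℝ) 1) ∧
      ∀ i, (legendreMonic n).eval (x i) = 0 := by
  obtain ⟨m, rfl⟩ : ∃ m, n = m + 1 := ⟨n - 1, by omega⟩
  obtain ⟨z, hz0, hz1, hz, hzq⟩ := exists_roots_iterate_derivative (m + 1) m (by omega)
  obtain ⟨y, hy⟩ := exists_interlacing_derivative_roots hz hzq
  have hzm : ∀ j ≤ m + 1, ∀ i ≤ j, z i ≤ z j := by
    intro j hj i hij
    induction j, hij using Nat.le_induction with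
    | base => rfl
    | succ j _ ih => exact (ih (by omega)).trans (hz j (by omega)).le
  refine ⟨fun i => y i, fun i j hij => ?_, fun i => ?_, fun i => ?_⟩
  · exact ((hy i (by omega)).1.2.trans_le (hzm j (by omega) _ hij)).trans (hy j (by omega)).1.1
  · have h := (hy i (by omega)).1
    have h0 := hzm i (by omega) 0 (by omega)
    have h1 := hzm (m + 1) le_rfl (i + 1) (by omega)
    rw [hz0] at h0
    rw [hz1] at h1
    exact ⟨h0.trans_lt h.1, h.2.trans_le h1⟩
  · rw [legendreMonic, eval_mul, Function.iterate_succ_apply', (hy i (by omega)).2, mul_zero]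

theorem legendreMonic_eq_prod {n : ℕ} {x : Fin n → ℝ} (hx : Function.Injective x)
    (hroot : ∀ i, (legendreMonic n).eval (x i) = 0) :
    legendreMonic n = ∏ i, (X - C (x i)) := by
  have hm : (∏ i, (X - C (x i))).Monic := monic_prod_X_sub_C x _
  have hdeg : (∏ i, (X - C (x i))).natDegree = n := by simp [natDegree_finsetProd_X_sub_C_eq_card]
  refine eq_of_degree_le_of_eval_index_eq Finset.univ hx.injOn ?_ ?_ ?_ ?_
  · rw [degree_eq_natDegree (monic_legendreMonic n).ne_zero, natDegree_legendreMonic]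
    simp
  · rw [degree_eq_natDegree (monic_legendreMonic n).ne_zero, natDegree_legendreMonic,
      degree_eq_natDegree hm.ne_zero, hdeg]
  · rw [(monic_legendreMonic n).leadingCoeff, hm.leadingCoeff]
  · intro i _
    rw [hroot, eval_prod, Finset.prod_eq_zero (Finset.mem_univ i) (by simp)]

theorem integral_iterate_derivative_mul (n : ℕ) {u : ℝ[X]} (h1 : (X - C 1) ^ n ∣ u)
    (h2 : (X - C (-1)) ^ n ∣ u) (q : ℝ[X]) :
    ∫ t in (-1 : ℝ)..1, (derivative^[n] u).eval t * q.eval t =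
      (-1) ^ n * ∫ t in (-1 : ℝ)..1, u.eval t * (derivative^[n] q).eval t := by
  induction n generalizing u with
  | zero => simp
  | succ n ih =>
    have hu1 : u.eval 1 = 0 := dvd_iff_isRoot.1 ((dvd_pow_self _ n.succ_ne_zero).trans h1)
    have hu2 : u.eval (-1) = 0 := dvd_iff_isRoot.1 ((dvd_pow_self _ n.succ_ne_zero).trans h2)
    have hd1 := pow_sub_one_dvd_derivative_of_pow_dvd h1
    have hd2 := pow_sub_one_dvd_derivative_of_pow_dvd h2
    rw [Nat.add_sub_cancel] at hd1 hd2
    have hparts := intervalIntegral.integral_mul_deriv_eq_deriv_mul (a := -1) (b := 1)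
        (fun t _ => u.hasDerivAt t) (fun t _ => (derivative^[n] q).hasDerivAt t)
        ((Polynomial.continuous _).intervalIntegrable _ _)
        ((Polynomial.continuous _).intervalIntegrable _ _)
    rw [Function.iterate_succ_apply, ih hd1 hd2, Function.iterate_succ_apply',
      hparts, hu1, hu2]
    ring

theorem integral_legendreMonic_mul (n : ℕ) (q : ℝ[X]) :
    ∫ t in (-1 : ℝ)..1, (legendreMonic n).eval t * q.eval t =
      n.factorial / (2 * n).factorial *
        ∫ t in (-1 : ℝ)..1, (1 - t ^ 2) ^ n * (derivative^[n] q).eval t := by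
  have h := integral_iterate_derivative_mul n
    (X_sub_C_pow_dvd_X_sq_sub_one_pow n (a := 1) (by norm_num))
    (X_sub_C_pow_dvd_X_sq_sub_one_pow n (a := -1) (by norm_num)) q
  simp only [legendreMonic, eval_mul, eval_C, mul_assoc, intervalIntegral.integral_const_mul]
  rw [h, ← intervalIntegral.integral_const_mul]
  congr 2
  ext t
  rw [← mul_assoc, eval_pow, ← mul_pow]
  simp

theorem integral_legendreMonic_mul_eq_zero {n : ℕ} {q : ℝ[X]} (hq : q.degree < n) :
    ∫ t in (-1 : ℝ)..1, (legendreMonic n).eval t * q.eval t = 0 := by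
  simp [integral_legendreMonic_mul, iterate_derivative_eq_zero_of_degree_lt hq]

theorem integral_one_sub_sq_pow_le (n : ℕ) :
    ∫ t in (-1 : ℝ)..1, (1 - t ^ 2) ^ n ≤
      Real.pi * ((2 * n).factorial / (4 ^ n * (n.factorial : ℝ) ^ 2)) := by
  have h := integral_sin_pow_odd_mul_cos_pow (a := 0) (b := Real.pi) n 0
  simp only [pow_zero, mul_one, one_mul, Real.cos_pi, Real.cos_zero] at h
  have hprod : ∏ i ∈ Finset.range n, (2 * (i : ℝ) + 1) / (2 * i + 2) =
      (2 * n).factorial / (4 ^ n * (n.factorial : ℝ) ^ 2) := by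
    clear h
    induction n with
    | zero => simp
    | succ n ih =>
      rw [Finset.prod_range_succ, ih, show 2 * (n + 1) = 2 * n + 1 + 1 by ring,
        Nat.factorial_succ, Nat.factorial_succ, Nat.factorial_succ]
      push_cast
      field_simp
      ring
  rw [← h, ← hprod, ← integral_sin_pow_even]
  exact integral_sin_pow_succ_le _

theorem integral_legendreMonic_sq_le (n : ℕ) :
    ∫ t in (-1 : ℝ)..1, (legendreMonic n).eval t ^ 2 ≤ Real.pi / 4 ^ n := by
  have hD : derivative^[n] (legendreMonic n) = C (n.factorial : ℝ) := by
    have h0 : (derivative^[n] (legendreMonic n)).natDegree = 0 := by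
      have := natDegree_iterate_derivative (legendreMonic n) n
      rw [natDegree_legendreMonic] at this
      omega
    rw [eq_C_of_natDegree_eq_zero h0, coeff_iterate_derivative, zero_add,
      coeff_legendreMonic_self, Nat.descFactorial_self]
    simp
  simp_rw [sq, integral_legendreMonic_mul, hD, eval_C, intervalIntegral.integral_mul_const]
  calc _ = (n.factorial : ℝ) ^ 2 / (2 * n).factorial * ∫ t in (-1 : ℝ)..1, (1 - t ^ 2) ^ n := by
        simp_rw [sq]; ring
    _ ≤ _ := mul_le_mul_of_nonneg_left (integral_one_sub_sq_pow_le n) (by positivity)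
    _ = _ := by field_simp

theorem differentiableOn_iteratedDeriv {U : Set ℂ} (hU : IsOpen U) {d : ℂ → ℂ}
    (hd : DifferentiableOn ℂ d U) (k : ℕ) : DifferentiableOn ℂ (iteratedDeriv k d) U := by
  rw [iteratedDeriv_eq_iterate]
  exact ((hd.analyticOnNhd hU).iterated_deriv k).differentiableOn

theorem hasDerivAt_iteratedDeriv {U : Set ℂ} (hU : IsOpen U) {d : ℂ → ℂ}
    (hd : DifferentiableOn ℂ d U) (k : ℕ) {z : ℂ} (hz : z ∈ U) :
    HasDerivAt (iteratedDeriv k d) (iteratedDeriv (k + 1) d z) z := by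
  rw [iteratedDeriv_succ]
  exact ((differentiableOn_iteratedDeriv hU hd k).differentiableAt (hU.mem_nhds hz)).hasDerivAt

/-- Leibniz rule for the product `(z - c) * dslope g c z`. -/
theorem iteratedDeriv_succ_eq_dslope {U : Set ℂ} (hU : IsOpen U) {g : ℂ → ℂ} {c : ℂ}
    (hd : DifferentiableOn ℂ (dslope g c) U) (k : ℕ) {z : ℂ} (hz : z ∈ U) :
    iteratedDeriv (k + 1) g z =
      (z - c) * iteratedDeriv (k + 1) (dslope g c) z
        + (k + 1) * iteratedDeriv k (dslope g c) z := by
  have hlin (w : ℂ) : HasDerivAt (fun w : ℂ => w - c) 1 w := (hasDerivAt_id w).sub_const c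
  induction k generalizing z with
  | zero =>
    have hg : g = fun w => g c + (w - c) * dslope g c w := by
      ext w
      have := sub_smul_dslope g c w
      rw [smul_eq_mul] at this
      rw [this]; ring
    rw [iteratedDeriv_succ, iteratedDeriv_zero]
    conv_lhs => rw [hg]
    have h0 := hasDerivAt_iteratedDeriv hU hd 0 hz
    rw [iteratedDeriv_zero] at h0
    refine (((hlin z).mul h0).const_add (g c)).deriv.trans ?_
    simp
    ring
  | succ k ih =>
    have hev : iteratedDeriv (k + 1) g =ᶠ[nhds z] fun w =>
        (w - c) * iteratedDeriv (k + 1) (dslope g c) w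
          + (k + 1) * iteratedDeriv k (dslope g c) w := by
      filter_upwards [hU.mem_nhds hz] with w hw using ih hw
    rw [iteratedDeriv_succ, hev.deriv_eq]
    refine (((hlin z).mul (hasDerivAt_iteratedDeriv hU hd (k + 1) hz)).add
      ((hasDerivAt_iteratedDeriv hU hd k hz).const_mul ((k : ℂ) + 1))).deriv.trans ?_
    push_cast
    ring

theorem norm_iteratedDeriv_dslope_le {U : Set ℂ} (hU : IsOpen U) {s : Set ℝ} (hs : Convex ℝ s)
    (hsU : ∀ t ∈ s, (t : ℂ) ∈ U) {g : ℂ → ℂ} {c : ℝ} (hc : c ∈ s)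
    (hd : DifferentiableOn ℂ (dslope g c) U) {k : ℕ} {M : ℝ}
    (hM : ∀ t ∈ s, ‖iteratedDeriv (k + 1) g (t : ℂ)‖ ≤ M) {t : ℝ} (ht : t ∈ s) :
    ‖iteratedDeriv k (dslope g c) (t : ℂ)‖ ≤ M / (k + 1) := by
  have hmem : ∀ τ ∈ Set.Icc (0 : ℝ) 1, c + τ * (t - c) ∈ s := fun τ hτ => by
    have := hs hc ht (sub_nonneg.2 hτ.2) hτ.1 (by ring)
    simp only [smul_eq_mul] at this
    convert this using 1; ring
  let ψ : ℝ → ℂ := fun τ =>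
    (τ : ℂ) ^ (k + 1) * iteratedDeriv k (dslope g c) ((c + τ * (t - c) : ℝ) : ℂ)
  have hψ : ∀ τ ∈ Set.Icc (0 : ℝ) 1, HasDerivAt ψ
      ((τ : ℂ) ^ k * iteratedDeriv (k + 1) g ((c + τ * (t - c) : ℝ) : ℂ)) τ := fun τ hτ => by
    have hzU := hsU _ (hmem τ hτ)
    have h1 : HasDerivAt (fun τ : ℝ => (τ : ℂ) ^ (k + 1)) ((k + 1 : ℂ) * (τ : ℂ) ^ k) τ := by
      simpa using (hasDerivAt_pow (k + 1) (τ : ℂ)).comp_ofReal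
    have h2 : HasDerivAt (fun τ : ℝ => ((c + τ * (t - c) : ℝ) : ℂ)) ((t : ℂ) - c) τ := by
      have : HasDerivAt (fun τ : ℝ => c + τ * (t - c)) (t - c) τ := by
        simpa using ((hasDerivAt_id τ).mul_const (t - c)).const_add c
      simpa using this.ofReal_comp
    have h3 := HasDerivAt.scomp τ (hasDerivAt_iteratedDeriv hU hd k hzU) h2
    refine (h1.mul h3).congr_deriv ?_
    rw [iteratedDeriv_succ_eq_dslope hU hd k hzU]
    simp only [smul_eq_mul, Function.comp]
    push_cast
    ring
  have hB : ∀ τ : ℝ, HasDerivAt (fun τ : ℝ => M * τ ^ (k + 1) / (k + 1)) (M * τ ^ k) τ :=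
    fun τ => by
      refine (((hasDerivAt_pow (k + 1) τ).const_mul M).div_const _).congr_deriv ?_
      have : (k : ℝ) + 1 ≠ 0 := by positivity
      push_cast
      field_simp
  have key := image_norm_le_of_norm_deriv_right_le_deriv_boundary
    (f := ψ) (a := 0) (b := 1)
    (fun τ hτ => (hψ τ hτ).continuousAt.continuousWithinAt)
    (fun τ hτ => (hψ τ ⟨hτ.1, hτ.2.le⟩).hasDerivWithinAt)
    (by simp [ψ]) hB
    (fun τ hτ => by
      rw [norm_mul, norm_pow, Complex.norm_real, Real.norm_of_nonneg hτ.1, mul_comm M]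
      exact mul_le_mul_of_nonneg_left (hM _ (hmem τ ⟨hτ.1, hτ.2.le⟩)) (pow_nonneg hτ.1 k))
    (Set.right_mem_Icc.2 zero_le_one)
  simpa [ψ] using key

/-- Newton's interpolation formula, with the normalized Taylor bounds
`‖g⁽ᵏ⁾‖ ≤ k! B rᵏ` on `s` transferred to the divided difference. -/
theorem exists_newton_remainder {U : Set ℂ} (hU : IsOpen U) {s : Set ℝ} (hs : Convex ℝ s)
    (hsU : ∀ t ∈ s, (t : ℂ) ∈ U) {r : ℝ} {n : ℕ} (x : Fin n → ℝ) (hx : ∀ i, x i ∈ s) {B : ℝ}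
    {g : ℂ → ℂ} (hg : DifferentiableOn ℂ g U)
    (hB : ∀ k : ℕ, ∀ t ∈ s, ‖iteratedDeriv k g (t : ℂ)‖ ≤ k.factorial * B * r ^ k) :
    ∃ (H : ℂ[X]) (d : ℂ → ℂ), H.degree < n ∧ DifferentiableOn ℂ d U ∧
      (∀ k : ℕ, ∀ t ∈ s, ‖iteratedDeriv k d (t : ℂ)‖ ≤ k.factorial * (B * r ^ n) * r ^ k) ∧
      ∀ z, g z = H.eval z + (∏ i, (z - x i)) * d z := by
  induction n generalizing g B with
  | zero => exact ⟨0, g, by simp, hg, by simpa using hB, by simp⟩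
  | succ n ih =>
    have hc := hx 0
    have hd : DifferentiableOn ℂ (dslope g (x 0)) U :=
      (Complex.differentiableOn_dslope (hU.mem_nhds (hsU _ hc))).2 hg
    obtain ⟨H, d, hH, hdd, hb, heq⟩ := ih (fun i => x i.succ) (fun i => hx _) (B := B * r) hd
      (fun k t ht => by
        refine (norm_iteratedDeriv_dslope_le hU hs hsU hc hd (hB (k + 1)) ht).trans_eq ?_
        have : (k : ℝ) + 1 ≠ 0 := by positivity
        rw [Nat.factorial_succ]
        push_cast
        field_simp
        ring)
    refine ⟨C (g (x 0)) + (X - C (x 0 : ℂ)) * H, d, ?_, hdd, ?_, fun z => ?_⟩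
    · refine (degree_add_le _ _).trans_lt (max_lt ?_ ?_)
      · exact degree_C_le.trans_lt (Nat.cast_pos'.2 n.succ_pos)
      · rw [degree_mul, degree_X_sub_C, add_comm]
        push_cast
        exact WithBot.add_lt_add_right (by simp) hH
    · intro k t ht
      refine (hb k t ht).trans_eq ?_
      ring
    · have := sub_smul_dslope g (x 0 : ℂ) z
      rw [smul_eq_mul, heq z] at this
      rw [Fin.prod_univ_succ]
      simp only [eval_add, eval_mul, eval_sub, eval_X, eval_C]
      linear_combination -this

theorem norm_iteratedDeriv_le_of_ball {f : ℂ → ℂ} {c : ℂ} {R F : ℝ} (hR : 0 < R)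
    (hf : DifferentiableOn ℂ f (Metric.ball c R)) (hF : ∀ z ∈ Metric.ball c R, ‖f z‖ ≤ F)
    (k : ℕ) : ‖iteratedDeriv k f c‖ ≤ k.factorial * F * R⁻¹ ^ k := by
  have hlim : Filter.Tendsto (fun r : ℝ => k.factorial * F / r ^ k) (nhdsWithin R (Set.Iio R))
      (nhds (k.factorial * F / R ^ k)) := by
    refine Filter.Tendsto.mono_left ?_ nhdsWithin_le_nhds
    exact tendsto_const_nhds.div (Filter.tendsto_id.pow k) (by positivity)
  rw [inv_pow, ← div_eq_mul_inv]
  refine ge_of_tendsto hlim ?_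
  filter_upwards [Ioo_mem_nhdsLT hR] with r hr
  refine Complex.norm_iteratedDeriv_le_of_forall_mem_sphere_norm_le k hr.1 ?_ fun z hz => ?_
  · exact (hf.mono (Metric.closedBall_subset_ball hr.2)).diffContOnCl_ball subset_rfl
  · exact hF z (Metric.closedBall_subset_ball hr.2 (Metric.sphere_subset_closedBall hz))

theorem integral_mul_eval_eq_sum_of_forall_pow {n : ℕ} {φ : ℝ[X]} {x w : Fin n → ℝ}
    (h : ∀ k < n, ∫ t in (-1 : ℝ)..1, φ.eval t * t ^ k = ∑ i, w i * (φ.eval (x i) * x i ^ k))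
    {H : ℂ[X]} (hH : H.degree < n) :
    ∫ t in (-1 : ℝ)..1, ((φ.eval t : ℝ) : ℂ) * H.eval (t : ℂ) =
      ∑ i, (w i : ℂ) * (((φ.eval (x i) : ℝ) : ℂ) * H.eval (x i : ℂ)) := by
  have heval (z : ℂ) : H.eval z = ∑ k ∈ Finset.range n, H.coeff k * z ^ k := by
    rcases eq_or_ne H 0 with rfl | h0
    · simp
    · exact eval_eq_sum_range' ((natDegree_lt_iff_degree_lt h0).2 hH) z
  have hterm (k : ℕ) (t : ℝ) : ((φ.eval t : ℝ) : ℂ) * (H.coeff k * (t : ℂ) ^ k) =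
      H.coeff k * ((φ.eval t * t ^ k : ℝ) : ℂ) := by
    push_cast
    ring
  simp_rw [heval, Finset.mul_sum, hterm]
  rw [intervalIntegral.integral_finsetSum fun k _ =>
    Continuous.intervalIntegrable (by fun_prop) _ _]
  rw [Finset.sum_comm]
  refine Finset.sum_congr rfl fun k hk => ?_
  rw [intervalIntegral.integral_const_mul, intervalIntegral.integral_ofReal,
    h k (Finset.mem_range.1 hk)]
  push_cast
  rw [Finset.mul_sum]
  exact Finset.sum_congr rfl fun i _ => by ring

/-- Interpolatory weights integrate polynomials of degree less than `n` exactly. -/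
theorem integral_eval_eq_sum_basis {n : ℕ} {x : Fin n → ℝ} (hx : Function.Injective x)
    {q : ℝ[X]} (hq : q.degree < n) :
    ∫ t in (-1 : ℝ)..1, q.eval t =
      ∑ i, (∫ t in (-1 : ℝ)..1, (Lagrange.basis Finset.univ x i).eval t) * q.eval (x i) := by
  have h := Lagrange.eq_interpolate (s := Finset.univ) hx.injOn (f := q) (by simpa using hq)
  rw [Lagrange.interpolate_apply] at h
  have heval (t : ℝ) :
      q.eval t = ∑ i, q.eval (x i) * (Lagrange.basis Finset.univ x i).eval t := by
    conv_lhs => rw [h]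
    simp [eval_finsetSum]
  rw [intervalIntegral.integral_congr fun t _ => heval t,
    intervalIntegral.integral_finsetSum fun k _ =>
      Continuous.intervalIntegrable (by fun_prop) _ _]
  refine Finset.sum_congr rfl fun i _ => ?_
  rw [intervalIntegral.integral_const_mul, mul_comm]

/-- Error bound for Gauss-Legendre quadrature on `[-1, 1]`. -/
theorem norm_gauss_legendre_error_le {n : ℕ} {x : Fin n → ℝ} (hx : Function.Injective x)
    (hmem : ∀ i, x i ∈ Set.Icc (-1 : ℝ) 1) (hroot : ∀ i, (legendreMonic n).eval (x i) = 0)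
    {U : Set ℂ} (hU : IsOpen U) (hsU : ∀ t ∈ Set.Icc (-1 : ℝ) 1, (t : ℂ) ∈ U) {r B : ℝ}
    {g : ℂ → ℂ} (hg : DifferentiableOn ℂ g U)
    (hB : ∀ k : ℕ, ∀ t ∈ Set.Icc (-1 : ℝ) 1,
      ‖iteratedDeriv k g (t : ℂ)‖ ≤ k.factorial * B * r ^ k) :
    ‖(∫ t in (-1 : ℝ)..1, g t) -
        ∑ i, ((∫ t in (-1 : ℝ)..1, (Lagrange.basis Finset.univ x i).eval t : ℝ) : ℂ) *
          g (x i)‖ ≤ B * r ^ (2 * n) * (Real.pi / 4 ^ n) := by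
  set w : Fin n → ℝ := fun i => ∫ t in (-1 : ℝ)..1, (Lagrange.basis Finset.univ x i).eval t
  obtain ⟨H₁, d₁, hH₁, hd₁, hB₁, hg₁⟩ :=
    exists_newton_remainder hU (convex_Icc _ _) hsU x hmem hg hB
  obtain ⟨H₂, d₂, hH₂, hd₂, hB₂, hg₂⟩ :=
    exists_newton_remainder hU (convex_Icc _ _) hsU x hmem hd₁ hB₁
  set p := legendreMonic n with hp
  have hprod (t : ℝ) : ∏ i, ((t : ℂ) - x i) = ((p.eval t : ℝ) : ℂ) := by
    rw [hp, legendreMonic_eq_prod hx hroot, eval_prod]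
    simp
  have hgt (t : ℝ) : g t = (((1 : ℝ[X]).eval t : ℝ) : ℂ) * H₁.eval (t : ℂ) +
      ((p.eval t : ℝ) : ℂ) * H₂.eval (t : ℂ) + ((p.eval t : ℝ) : ℂ) ^ 2 * d₂ t := by
    rw [hg₁, hg₂, hprod, eval_one]
    push_cast
    ring
  have hq₁ := integral_mul_eval_eq_sum_of_forall_pow (φ := 1) (x := x) (w := w) (fun k hk => by
    simpa using integral_eval_eq_sum_basis hx (q := X ^ k)
      (by rw [degree_X_pow]; exact_mod_cast hk)) hH₁
  have hq₂ := integral_mul_eval_eq_sum_of_forall_pow (φ := p) (x := x) (w := w) (fun k hk => by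
    simpa [hroot] using integral_legendreMonic_mul_eq_zero (q := X ^ k)
      (by rw [degree_X_pow]; exact_mod_cast hk)) hH₂
  have hint : IntervalIntegrable (fun t : ℝ => ((p.eval t : ℝ) : ℂ) ^ 2 * d₂ t)
      MeasureTheory.volume (-1) 1 := by
    refine ContinuousOn.intervalIntegrable_of_Icc (by norm_num) ?_
    refine ContinuousOn.mul (by fun_prop) ?_
    exact hd₂.continuousOn.comp Complex.continuous_ofReal.continuousOn hsU
  have herr : (∫ t in (-1 : ℝ)..1, g t) - ∑ i, (w i : ℂ) * g (x i) =
      ∫ t in (-1 : ℝ)..1, ((p.eval t : ℝ) : ℂ) ^ 2 * d₂ t := by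
    simp_rw [hgt]
    rw [intervalIntegral.integral_add (Continuous.intervalIntegrable (by fun_prop) _ _) hint,
      intervalIntegral.integral_add (Continuous.intervalIntegrable (by fun_prop) _ _)
        (Continuous.intervalIntegrable (by fun_prop) _ _), hq₁, hq₂]
    simp_rw [mul_add, Finset.sum_add_distrib]
    simp [hroot]
  have hd0 (t : ℝ) (ht : t ∈ Set.Icc (-1 : ℝ) 1) : ‖d₂ t‖ ≤ B * r ^ (2 * n) := by
    refine (hB₂ 0 t ht).trans_eq ?_
    simp
    ring
  have hB0 : 0 ≤ B * r ^ (2 * n) := (norm_nonneg _).trans (hd0 0 (by norm_num))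
  rw [herr]
  calc _ ≤ ∫ t in (-1 : ℝ)..1, p.eval t ^ 2 * (B * r ^ (2 * n)) := by
        refine intervalIntegral.norm_integral_le_of_norm_le (by norm_num) ?_
          (Continuous.intervalIntegrable (by fun_prop) _ _)
        refine Filter.Eventually.of_forall fun t ht => ?_
        rw [norm_mul, norm_pow, Complex.norm_real, Real.norm_eq_abs, sq_abs]
        exact mul_le_mul_of_nonneg_left (hd0 t ⟨ht.1.le, ht.2⟩) (sq_nonneg _)
    _ ≤ _ := by
        rw [intervalIntegral.integral_mul_const, mul_comm]
        exact mul_le_mul_of_nonneg_left (integral_legendreMonic_sq_le n) hB0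

/-- Scaled Gauss–Legendre quadrature with analytic error bound: for every `n ≥ 1` there exist
nodes `x_1 < ⋯ < x_n` in `(−1,1)` (the zeros of `p_n`) and weights `w_1, …, w_n` such that
for all real `a < b` and every complex-analytic `f` on the union of the open unit balls
centered at the points of `[a,b]`, bounded by `F` there,
`|∫_a^b f − Σ_i w_i ((b−a)/2) f((a+b)/2 + ((b−a)/2)x_i)| ≤ π·2^{−2n}·((b−a)/2)^{2n+1}·F`. -/
theorem gauss_legendre_quadrature_analytic (n : ℕ) (hn : 1 ≤ n) :
    ∃ (x : Fin n → ℝ) (w : Fin n → ℝ), StrictMono x ∧ (∀ i, x i ∈ Set.Ioo (-1:ℝ) 1) ∧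
      (∀ i, (legendreMonic n).eval (x i) = 0) ∧
      ∀ (a b : ℝ), a < b → ∀ (f : ℂ → ℂ) (F : ℝ),
        DifferentiableOn ℂ f (⋃ t ∈ Set.Icc a b, Metric.ball (t : ℂ) 1) →
        (∀ z ∈ ⋃ t ∈ Set.Icc a b, Metric.ball (t : ℂ) 1, ‖f z‖ ≤ F) →
        ‖(∫ t in a..b, f t) -
            ∑ i : Fin n, (w i : ℂ) * (((b - a) / 2 : ℝ) : ℂ) *
              f (((a + b) / 2 + (b - a) / 2 * x i : ℝ) : ℂ)‖ ≤
          Real.pi * (2:ℝ) ^ (-(2 * (n:ℤ))) * ((b - a) / 2) ^ (2 * n + 1) * F := by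
  obtain ⟨x, hmono, hmem, hroot⟩ := exists_legendreMonic_roots n hn
  refine ⟨x, fun i => ∫ t in (-1 : ℝ)..1, (Lagrange.basis Finset.univ x i).eval t,
    hmono, hmem, hroot, fun a b hab f F hf hF => ?_⟩
  have hh : 0 < (b - a) / 2 := by linarith
  set h := (b - a) / 2 with hhdef
  set m := (a + b) / 2 with hmdef
  let L : ℂ → ℂ := fun z => m + h * z
  have hmaps : ∀ t ∈ Set.Icc (-1 : ℝ) 1, Set.MapsTo L (Metric.ball (t : ℂ) h⁻¹)
      (⋃ t ∈ Set.Icc a b, Metric.ball (t : ℂ) 1) := fun t ht z hz => by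
    refine Set.mem_biUnion (x := m + h * t) ⟨?_, ?_⟩ ?_
    · nlinarith [ht.1]
    · nlinarith [ht.2]
    · rw [mem_ball_iff_norm] at hz ⊢
      have : L z - ((m + h * t : ℝ) : ℂ) = (h : ℂ) * (z - t) := by
        simp only [L]
        push_cast
        ring
      rw [this, norm_mul, Complex.norm_real, Real.norm_of_nonneg hh.le]
      calc h * ‖z - t‖ < h * h⁻¹ := mul_lt_mul_of_pos_left hz hh
        _ = 1 := mul_inv_cancel₀ hh.ne'
  have hL : Differentiable ℂ L := by fun_prop
  set U : Set ℂ := ⋃ t ∈ Set.Icc (-1 : ℝ) 1, Metric.ball (t : ℂ) h⁻¹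
  have hUopen : IsOpen U := isOpen_biUnion fun _ _ => Metric.isOpen_ball
  have hballU : ∀ t ∈ Set.Icc (-1 : ℝ) 1, Metric.ball (t : ℂ) h⁻¹ ⊆ U := fun t ht =>
    Set.subset_biUnion_of_mem (u := fun t : ℝ => Metric.ball (t : ℂ) h⁻¹) ht
  have hg : DifferentiableOn ℂ (f ∘ L) U :=
    hf.comp hL.differentiableOn (Set.mapsTo_iUnion₂.2 hmaps)
  have key := norm_gauss_legendre_error_le hmono.injective
    (fun i => Set.Ioo_subset_Icc_self (hmem i)) hroot hUopen
    (fun t ht => hballU t ht (Metric.mem_ball_self (by positivity))) (r := h) (B := F) hg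
    (fun k t ht => by
      simpa using norm_iteratedDeriv_le_of_ball (inv_pos.2 hh) (hg.mono (hballU t ht))
        (fun z hz => hF _ (hmaps t ht hz)) k)
  have hsubst : ∫ t in a..b, f t = (h : ℂ) * ∫ t in (-1 : ℝ)..1, (f ∘ L) t := by
    have := intervalIntegral.smul_integral_comp_add_mul (a := -1) (b := 1)
      (fun t : ℝ => f (t : ℂ)) h m
    rw [show m + h * -1 = a by rw [hhdef, hmdef]; ring,
      show m + h * 1 = b by rw [hhdef, hmdef]; ring] at this
    rw [← this, Complex.real_smul]
    simp [L]
  rw [hsubst]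
  have hsum (w : Fin n → ℝ) : ∑ i, (w i : ℂ) * (h : ℂ) * f ((m + h * x i : ℝ) : ℂ) =
      (h : ℂ) * ∑ i, (w i : ℂ) * (f ∘ L) (x i) := by
    rw [Finset.mul_sum]
    refine Finset.sum_congr rfl fun i _ => ?_
    simp [L]
    ring
  rw [hsum, ← mul_sub, norm_mul, Complex.norm_real, Real.norm_of_nonneg hh.le]
  refine (mul_le_mul_of_nonneg_left key hh.le).trans_eq ?_
  rw [zpow_neg, zpow_mul, zpow_natCast]
  norm_num
  field_simp
  ring
end

section
/- Contour-shift identity for the half Bessel function: let n ≥ 0 be an integer, set ν := n − 1/2, and for real z > 0 set ω := z − π/4 − nπ/2. Then ((z/2)^n / (Γ(n+1/2) Γ(1/2))) ∫_{−1}^{1} e^{i z t} (1−t²)^{n−1/2} dt = ((2πz)^{−1/2} / Γ(ν+1)) ∫_0^∞ e^{−u} u^{ν} [ e^{−iω} (1 − iu/(2z))^{ν} + e^{iω} (1 + iu/(2z))^{ν} ] du, where complex powers are taken with the principal branch. -/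
open Complex Real

/-- The half Bessel function `J_n^+`, defined via the Poisson-type integral
`J_n^+(z) = ((z/2)^n/(Γ(n+1/2)Γ(1/2))) ∫_{−1}^{1} e^{izt}(1−t²)^{n−1/2} dt`,
with the principal branch power. -/
noncomputable def besselJPlus (n : ℕ) (z : ℂ) : ℂ :=
  ((z / 2) ^ n / ((Real.Gamma ((n : ℝ) + 1 / 2) : ℂ) * (Real.Gamma (1 / 2) : ℂ))) *
    ∫ t in (-1:ℝ)..1, Complex.exp (Complex.I * z * (t : ℂ)) *
      ((1 : ℂ) - (t : ℂ) ^ 2) ^ ((((n : ℝ) - 1 / 2 : ℝ)) : ℂ)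


theorem rpow_natCast_sub_half_le (n : ℕ) {x m M : ℝ} (hm : 0 < m) (hmx : m ≤ x) (hxM : x ≤ M) :
    x ^ ((n : ℝ) - 1 / 2) ≤ M ^ n * (1 / √m) := by
  have hx : 0 < x := hm.trans_le hmx
  rw [Real.rpow_sub hx, Real.rpow_natCast, ← Real.sqrt_eq_rpow, div_eq_mul_one_div]
  have : 0 < √m := Real.sqrt_pos.2 hm
  have : 0 ≤ M := hx.le.trans hxM
  gcongr

theorem one_sub_sq_mem_slitPlane {t : ℂ} (ht : 0 < t.im) : 1 - t ^ 2 ∈ slitPlane := by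
  rw [mem_slitPlane_iff]
  by_cases h : t.re = 0
  · left
    simp only [sq, sub_re, one_re, mul_re, h]
    nlinarith
  · right
    simp only [sq, sub_im, one_im, mul_im]
    intro h0
    have : t.re * t.im = 0 := by linarith
    rcases mul_eq_zero.1 this with h1 | h1
    · exact h h1
    · exact ht.ne' h1

/-- The integrand of the Poisson integral, as a function of a complex variable. -/
noncomputable def poissonIntegrand (ν z : ℝ) (t : ℂ) : ℂ :=
  Complex.exp (Complex.I * z * t) * (1 - t ^ 2) ^ (ν : ℂ)

theorem differentiableAt_poissonIntegrand (ν z : ℝ) {t : ℂ} (ht : 1 - t ^ 2 ∈ slitPlane) :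
    DifferentiableAt ℂ (poissonIntegrand ν z) t := by
  unfold poissonIntegrand
  refine DifferentiableAt.mul (by fun_prop) (DifferentiableAt.cpow (by fun_prop) (by fun_prop) ht)

theorem measurable_poissonIntegrand (ν z : ℝ) : Measurable (poissonIntegrand ν z) := by
  unfold poissonIntegrand
  fun_prop

theorem norm_poissonIntegrand (ν z : ℝ) (t : ℂ) :
    ‖poissonIntegrand ν z t‖ = Real.exp (-(z * t.im)) * ‖1 - t ^ 2‖ ^ ν := by
  rw [poissonIntegrand, norm_mul, norm_cpow_real, norm_exp]
  simp

theorem norm_one_sub_sq_le {t : ℂ} {r : ℝ} (ht : ‖t‖ ≤ r) : ‖1 - t ^ 2‖ ≤ 1 + r ^ 2 := by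
  calc ‖1 - t ^ 2‖ ≤ ‖(1 : ℂ)‖ + ‖t ^ 2‖ := norm_sub_le _ _
    _ ≤ 1 + r ^ 2 := by rw [norm_one, norm_pow]; gcongr

theorem norm_ofReal_add_ofReal_mul_I_le {x y : ℝ} (hx : |x| ≤ 1) (hy : 0 ≤ y) :
    ‖(x + y * I : ℂ)‖ ≤ 1 + y := by
  calc ‖(x + y * I : ℂ)‖ ≤ ‖(x : ℂ)‖ + ‖(y * I : ℂ)‖ := norm_add_le _ _
    _ ≤ 1 + y := by
      simp only [norm_mul, norm_I, norm_real, mul_one, Real.norm_eq_abs, abs_of_nonneg hy]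
      exact add_le_add_left hx y

theorem one_sub_sq_le_norm (x y : ℝ) :
    1 - x ^ 2 ≤ ‖1 - (x + y * I : ℂ) ^ 2‖ := by
  have h : (1 - (x + y * I : ℂ) ^ 2).re = 1 - x ^ 2 + y ^ 2 := by
    simp [sq]; ring
  calc 1 - x ^ 2 ≤ (1 - (x + y * I : ℂ) ^ 2).re := by rw [h]; nlinarith [sq_nonneg y]
    _ ≤ _ := re_le_norm _

theorem sq_im_le_norm_one_sub_sq (x y : ℝ) : y ^ 2 ≤ ‖1 - (x + y * I : ℂ) ^ 2‖ := by
  have h : (1 - (x + y * I : ℂ) ^ 2) = (1 - (x + y * I)) * (1 + (x + y * I)) := by ring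
  have h1 : |y| ≤ ‖1 - (x + y * I : ℂ)‖ := by
    simpa using abs_im_le_norm (1 - (x + y * I : ℂ))
  have h2 : |y| ≤ ‖1 + (x + y * I : ℂ)‖ := by
    simpa using abs_im_le_norm (1 + (x + y * I : ℂ))
  rw [h, norm_mul, ← sq_abs, sq]
  gcongr

theorem intervalIntegrable_one_div_sqrt_one_sub_sq :
    IntervalIntegrable (fun x : ℝ ↦ 1 / √(1 - x ^ 2)) MeasureTheory.volume (-1) 1 := by
  refine intervalIntegral.intervalIntegrable_deriv_of_nonneg (g := Real.arcsin)
    Real.continuous_arcsin.continuousOn (fun x hx ↦ ?_) (fun x _ ↦ by positivity)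
  norm_num at hx
  exact Real.hasDerivAt_arcsin hx.1.ne' hx.2.ne

theorem tendsto_integral_poissonIntegrand_bottom (n : ℕ) {z : ℝ} (hz : 0 < z) :
    Filter.Tendsto (fun R : ℝ ↦ ∫ x in (-1 : ℝ)..1,
        poissonIntegrand ((n : ℝ) - 1 / 2) z (x + (R⁻¹ : ℝ) * I)) Filter.atTop
      (nhds (∫ x in (-1 : ℝ)..1, poissonIntegrand ((n : ℝ) - 1 / 2) z x)) := by
  refine intervalIntegral.tendsto_integral_filter_of_dominated_convergence
    (fun x ↦ 5 ^ n * (1 / √(1 - x ^ 2))) ?_ ?_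
    (intervalIntegrable_one_div_sqrt_one_sub_sq.const_mul _) ?_
  · filter_upwards with R
    exact ((measurable_poissonIntegrand _ _).comp (by fun_prop)).aestronglyMeasurable
  · filter_upwards [Filter.eventually_ge_atTop 1] with R hR
    filter_upwards [MeasureTheory.Measure.ae_ne MeasureTheory.volume (1 : ℝ)] with x hx1 hx
    rw [Set.uIoc_of_le (by norm_num)] at hx
    have hxlt : x < 1 := lt_of_le_of_ne hx.2 hx1
    have hx' : |x| ≤ 1 := abs_le.2 ⟨hx.1.le, hx.2⟩
    have hR0 : 0 ≤ R⁻¹ := by positivity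
    have hR1 : R⁻¹ ≤ 1 := inv_le_one_of_one_le₀ hR
    rw [norm_poissonIntegrand]
    have hexp : Real.exp (-(z * ((x + (R⁻¹ : ℝ) * I : ℂ)).im)) ≤ 1 := by
      rw [Real.exp_le_one_iff]
      simpa using by positivity
    have hpow := rpow_natCast_sub_half_le n (m := 1 - x ^ 2) (M := 5)
      (by nlinarith [hx.1]) (one_sub_sq_le_norm x R⁻¹)
      ((norm_one_sub_sq_le ((norm_ofReal_add_ofReal_mul_I_le hx' hR0).trans
        (by linarith : 1 + R⁻¹ ≤ 2))).trans (by norm_num))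
    calc _ ≤ 1 * _ := mul_le_mul hexp hpow (by positivity) zero_le_one
      _ = _ := one_mul _
  · filter_upwards [MeasureTheory.Measure.ae_ne MeasureTheory.volume (1 : ℝ)] with x hx1 hx
    rw [Set.uIoc_of_le (by norm_num)] at hx
    have hxlt : x < 1 := lt_of_le_of_ne hx.2 hx1
    have hc : ContinuousAt (poissonIntegrand ((n : ℝ) - 1 / 2) z) x := by
      refine (differentiableAt_poissonIntegrand _ _ ?_).continuousAt
      have : (1 - (x : ℂ) ^ 2) = ((1 - x ^ 2 : ℝ) : ℂ) := by push_cast; ring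
      rw [this, ofReal_mem_slitPlane]
      nlinarith [hx.1]
    refine hc.tendsto.comp ?_
    have : Filter.Tendsto (fun R : ℝ ↦ (x : ℂ) + (R⁻¹ : ℝ) * I) Filter.atTop
        (nhds (x + (0 : ℝ) * I)) :=
      ((continuous_ofReal.tendsto 0).comp tendsto_inv_atTop_zero |>.mul_const I).const_add _
    simpa using this

theorem tendsto_integral_poissonIntegrand_top (n : ℕ) {z : ℝ} (hz : 0 < z) :
    Filter.Tendsto (fun R : ℝ ↦ ∫ x in (-1 : ℝ)..1,
        poissonIntegrand ((n : ℝ) - 1 / 2) z (x + R * I)) Filter.atTop (nhds 0) := by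
  have hlim : Filter.Tendsto (fun R : ℝ ↦
      (2 * Real.exp z) * ((1 + R) ^ (2 * n) / Real.exp (z * (1 + R)) * 2 ^ n)) Filter.atTop
      (nhds 0) := by
    have h := ((isLittleO_pow_exp_pos_mul_atTop (2 * n) hz).tendsto_div_nhds_zero.comp
      (Filter.tendsto_atTop_add_const_left Filter.atTop 1 Filter.tendsto_id)).mul_const (2 ^ n)
    simpa using h.const_mul (2 * Real.exp z)
  refine squeeze_zero_norm' ?_ hlim
  filter_upwards [Filter.eventually_ge_atTop 1] with R hR
  have key : ∀ x ∈ Set.uIoc (-1 : ℝ) 1,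
      ‖poissonIntegrand ((n : ℝ) - 1 / 2) z (x + R * I)‖ ≤
        Real.exp (-(z * R)) * ((1 + R) ^ (2 * n) * 2 ^ n) := by
    intro x hx
    rw [Set.uIoc_of_le (by norm_num)] at hx
    have hx' : |x| ≤ 1 := abs_le.2 ⟨hx.1.le, hx.2⟩
    have hpow := rpow_natCast_sub_half_le n (m := 1) (M := (1 + R) ^ 2 * 2) one_pos
      ((by nlinarith : 1 ≤ R ^ 2).trans (sq_im_le_norm_one_sub_sq x R))
      ((norm_one_sub_sq_le (norm_ofReal_add_ofReal_mul_I_le hx' (by linarith))).trans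
        (by nlinarith))
    rw [norm_poissonIntegrand, show (x + R * I : ℂ).im = R by simp]
    gcongr
    simpa [mul_pow, pow_mul] using hpow
  refine (intervalIntegral.norm_integral_le_of_norm_le_const key).trans (le_of_eq ?_)
  rw [mul_add, Real.exp_add, Real.exp_neg]
  norm_num
  field_simp

theorem one_sub_sq_cpow_of_re_eq_one_or_neg_one {σ s : ℝ} (hσ : σ = 1 ∨ σ = -1) (hs : 0 < s)
    (ν : ℂ) :
    (1 - (σ + s * I : ℂ) ^ 2) ^ ν =
      Complex.exp (-(σ * Real.pi * ν / 2 * I)) * ((2 * s : ℝ) : ℂ) ^ ν *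
        (1 + I * σ * s / 2) ^ ν := by
  have hσ2 : (σ : ℂ) ^ 2 = 1 := by rcases hσ with rfl | rfl <;> norm_num
  have hfac : 1 - (σ + s * I : ℂ) ^ 2 = ((2 * s : ℝ) : ℂ) * ((1 + I * σ * s / 2) * (-(σ * I))) := by
    push_cast
    linear_combination (-1 + s ^ 2 * I ^ 2) * hσ2
  have hre : (1 + I * σ * s / 2 : ℂ).re = 1 := by simp
  have hw : (1 + I * σ * s / 2 : ℂ) ≠ 0 := fun h ↦ by simp [h] at hre
  have hσI : (-(σ * I) : ℂ) ≠ 0 := by rcases hσ with rfl | rfl <;> simp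
  have harg := abs_lt.1 (abs_arg_lt_pi_div_two_iff.2 (.inl (hre ▸ one_pos)))
  have hlogσ : log (-(σ * I)) = -(σ * Real.pi / 2 * I) := by
    rcases hσ with rfl | rfl
    · simp [log_neg_I]
    · simp [log_I]; ring
  have hargσ : arg (-(σ * I)) = -(σ * Real.pi / 2) := by
    rcases hσ with rfl | rfl
    · simp [arg_neg_I]
    · simp [arg_I]; ring
  have hsum : arg (1 + I * σ * s / 2) + arg (-(σ * I)) ∈ Set.Ioc (-Real.pi) Real.pi := by
    rw [hargσ]
    rcases hσ with rfl | rfl <;> constructor <;> linarith [harg.1, harg.2]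
  have hs2 : ((2 * s : ℝ) : ℂ) ≠ 0 := by exact_mod_cast (by positivity : 2 * s ≠ 0)
  rw [hfac, cpow_def_of_ne_zero (mul_ne_zero hs2 (mul_ne_zero hw hσI)),
    cpow_def_of_ne_zero hs2, cpow_def_of_ne_zero hw,
    log_ofReal_mul (by positivity) (mul_ne_zero hw hσI), log_mul hw hσI hsum, hlogσ,
    ← ofReal_log (by positivity), ← Complex.exp_add, ← Complex.exp_add]
  ring_nf

/-- One of the two Laplace-type integrands produced by moving the Poisson contour onto the vertical
half-lines through `1` (`σ = 1`) and `-1` (`σ = -1`). -/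
noncomputable def laplaceIntegrand (ν z σ u : ℝ) : ℂ :=
  (Real.exp (-u) : ℂ) * (u : ℂ) ^ (ν : ℂ) * (1 + I * σ * u / (2 * z)) ^ (ν : ℂ)

theorem integrableOn_laplaceIntegrand (n : ℕ) {z σ : ℝ} (hz : 0 < z) (hσ : σ = 1 ∨ σ = -1) :
    MeasureTheory.IntegrableOn (laplaceIntegrand ((n : ℝ) - 1 / 2) z σ) (Set.Ioi 0) := by
  have hbound : MeasureTheory.IntegrableOn (fun u : ℝ ↦
      (n.factorial * z⁻¹ ^ n * Real.exp z) *
        (u ^ ((n : ℝ) - 1 / 2) * Real.exp (-(1 / 2) * u ^ (1 : ℝ)))) (Set.Ioi 0) :=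
    (integrableOn_rpow_mul_exp_neg_mul_rpow (by linarith [(n.cast_nonneg : (0 : ℝ) ≤ n)]) one_pos
      (by norm_num)).const_mul _
  refine hbound.mono' (Measurable.aestronglyMeasurable ?_) ?_
  · unfold laplaceIntegrand
    fun_prop
  filter_upwards [MeasureTheory.ae_restrict_mem measurableSet_Ioi] with u (hu : 0 < u)
  have hre : (1 + I * σ * u / (2 * z) : ℂ).re = 1 := by
    rw [show (I * σ * u / (2 * z) : ℂ) = ((σ * u / (2 * z) : ℝ) : ℂ) * I by push_cast; ring,
      add_re, re_ofReal_mul, I_re, mul_zero, add_zero, one_re]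
  have hone : 1 ≤ ‖(1 + I * σ * u / (2 * z) : ℂ)‖ := hre ▸ re_le_norm _
  have hle : ‖(1 + I * σ * u / (2 * z) : ℂ)‖ ≤ 1 + u / (2 * z) := by
    refine (norm_add_le _ _).trans ?_
    have : |σ| = 1 := by rcases hσ with rfl | rfl <;> simp
    simp [this, abs_of_pos hu, abs_of_pos hz]
  have hpow := rpow_natCast_sub_half_le n one_pos hone hle
  have hexp := Real.pow_div_factorial_le_exp (z + u / 2) (by positivity) n
  rw [div_le_iff₀ (by positivity), Real.exp_add] at hexp
  have hmain : (1 + u / (2 * z)) ^ n ≤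
      n.factorial * z⁻¹ ^ n * Real.exp z * Real.exp (u / 2) := by
    have : 1 + u / (2 * z) = z⁻¹ * (z + u / 2) := by field_simp
    rw [this, mul_pow]
    calc _ ≤ z⁻¹ ^ n * (Real.exp z * Real.exp (u / 2) * n.factorial) := by gcongr
      _ = _ := by ring
  rw [laplaceIntegrand, norm_mul, norm_mul, norm_cpow_real, norm_cpow_real, norm_real, norm_real,
    Real.norm_of_nonneg (Real.exp_pos _).le, Real.norm_of_nonneg hu.le, Real.rpow_one]
  have hsplit : Real.exp (-(1 / 2) * u) = Real.exp (-u) * Real.exp (u / 2) := by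
    rw [← Real.exp_add]; ring_nf
  rw [hsplit]
  calc _ ≤ Real.exp (-u) * u ^ ((n : ℝ) - 1 / 2) *
        (n.factorial * z⁻¹ ^ n * Real.exp z * Real.exp (u / 2)) := by
        gcongr
        exact hpow.trans (by simpa using hmain)
    _ = _ := by ring

theorem poissonIntegrand_vertical (ν : ℝ) {z σ s : ℝ} (hz : 0 < z) (hσ : σ = 1 ∨ σ = -1)
    (hs : 0 < s) :
    poissonIntegrand ν z (σ + s * I) =
      Complex.exp (σ * I * (z - Real.pi * ν / 2)) * ((2 / z : ℝ) : ℂ) ^ (ν : ℂ) *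
        laplaceIntegrand ν z σ (z * s) := by
  have hz' : (z : ℂ) ≠ 0 := ofReal_ne_zero.2 hz.ne'
  have h2s : ((2 * s : ℝ) : ℂ) ^ (ν : ℂ) =
      ((2 / z : ℝ) : ℂ) ^ (ν : ℂ) * ((z * s : ℝ) : ℂ) ^ (ν : ℂ) := by
    rw [← mul_cpow_ofReal_nonneg (by positivity) (by positivity), ← ofReal_mul]
    congr 2
    field_simp
  have hw : (1 + I * σ * ((z * s : ℝ) : ℂ) / (2 * z) : ℂ) = 1 + I * σ * s / 2 := by
    push_cast
    field_simp
  have hexp : Complex.exp (I * z * (σ + s * I)) * Complex.exp (-(σ * Real.pi * ν / 2 * I)) =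
      Complex.exp (σ * I * (z - Real.pi * ν / 2)) * (Real.exp (-(z * s)) : ℂ) := by
    rw [ofReal_exp, ← Complex.exp_add, ← Complex.exp_add]
    congr 1
    push_cast
    linear_combination (z * s : ℂ) * I_sq
  rw [poissonIntegrand, laplaceIntegrand, one_sub_sq_cpow_of_re_eq_one_or_neg_one hσ hs, h2s, hw]
  linear_combination (((2 / z : ℝ) : ℂ) ^ (ν : ℂ) * ((z * s : ℝ) : ℂ) ^ (ν : ℂ) *
    (1 + I * σ * s / 2) ^ (ν : ℂ)) * hexp

theorem integrableOn_poissonIntegrand_vertical (n : ℕ) {z σ : ℝ} (hz : 0 < z)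
    (hσ : σ = 1 ∨ σ = -1) :
    MeasureTheory.IntegrableOn
      (fun s : ℝ ↦ poissonIntegrand ((n : ℝ) - 1 / 2) z (σ + s * I)) (Set.Ioi 0) := by
  have h : MeasureTheory.IntegrableOn
      (fun s ↦ laplaceIntegrand ((n : ℝ) - 1 / 2) z σ (z * s)) (Set.Ioi 0) := by
    rw [MeasureTheory.integrableOn_Ioi_comp_mul_left_iff _ _ hz, mul_zero]
    exact integrableOn_laplaceIntegrand n hz hσ
  exact MeasureTheory.IntegrableOn.congr_fun (h.const_mul _)
    (fun s hs ↦ (poissonIntegrand_vertical _ hz hσ hs).symm) measurableSet_Ioi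

theorem integral_poissonIntegrand_vertical (ν : ℝ) {z σ : ℝ} (hz : 0 < z) (hσ : σ = 1 ∨ σ = -1) :
    ∫ s in Set.Ioi (0 : ℝ), poissonIntegrand ν z (σ + s * I) =
      Complex.exp (σ * I * (z - Real.pi * ν / 2)) * ((2 / z : ℝ) : ℂ) ^ (ν : ℂ) * (z : ℂ)⁻¹ *
        ∫ u in Set.Ioi (0 : ℝ), laplaceIntegrand ν z σ u := by
  rw [MeasureTheory.setIntegral_congr_fun measurableSet_Ioi
      (fun s hs ↦ poissonIntegrand_vertical ν hz hσ hs), MeasureTheory.integral_const_mul,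
    MeasureTheory.integral_comp_mul_left_Ioi (laplaceIntegrand ν z σ) 0 hz, mul_zero, real_smul]
  push_cast
  ring

theorem tendsto_intervalIntegral_inv_self_integral_Ioi {f : ℝ → ℂ}
    (hf : MeasureTheory.IntegrableOn f (Set.Ioi 0)) :
    Filter.Tendsto (fun R : ℝ ↦ ∫ s in R⁻¹..R, f s) Filter.atTop
      (nhds (∫ s in Set.Ioi (0 : ℝ), f s)) := by
  have hcover := (MeasureTheory.aecover_Ioi_of_Ioi (μ := MeasureTheory.volume)
    (tendsto_inv_atTop_zero (𝕜 := ℝ))).inter (MeasureTheory.aecover_Iic Filter.tendsto_id)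
  refine (hcover.integral_tendsto_of_countably_generated hf).congr' ?_
  filter_upwards [Filter.eventually_ge_atTop 1] with R hR
  have hR0 : 0 < R⁻¹ := by positivity
  have hsub : Set.Ioc R⁻¹ R ⊆ Set.Ioi 0 := fun s hs ↦ hR0.trans hs.1
  rw [intervalIntegral.integral_of_le ((inv_le_one_of_one_le₀ hR).trans hR), id, Set.Ioi_inter_Iic,
    MeasureTheory.Measure.restrict_restrict measurableSet_Ioc,
    Set.inter_eq_left.2 hsub]

theorem integral_poissonIntegrand_eq (n : ℕ) {z : ℝ} (hz : 0 < z) :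
    ∫ x in (-1 : ℝ)..1, poissonIntegrand ((n : ℝ) - 1 / 2) z x =
      I * (∫ s in Set.Ioi (0 : ℝ), poissonIntegrand ((n : ℝ) - 1 / 2) z (-1 + s * I)) -
        I * ∫ s in Set.Ioi (0 : ℝ), poissonIntegrand ((n : ℝ) - 1 / 2) z (1 + s * I) := by
  set f := poissonIntegrand ((n : ℝ) - 1 / 2) z
  have hright : Filter.Tendsto (fun R : ℝ ↦ ∫ s in R⁻¹..R, f (1 + s * I)) Filter.atTop
      (nhds (∫ s in Set.Ioi (0 : ℝ), f (1 + s * I))) := by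
    simpa only [ofReal_neg, ofReal_one] using tendsto_intervalIntegral_inv_self_integral_Ioi
      (integrableOn_poissonIntegrand_vertical n hz (.inl rfl))
  have hleft : Filter.Tendsto (fun R : ℝ ↦ ∫ s in R⁻¹..R, f (-1 + s * I)) Filter.atTop
      (nhds (∫ s in Set.Ioi (0 : ℝ), f (-1 + s * I))) := by
    simpa only [ofReal_neg, ofReal_one] using tendsto_intervalIntegral_inv_self_integral_Ioi
      (integrableOn_poissonIntegrand_vertical n hz (.inr rfl))
  have hlim := (((tendsto_integral_poissonIntegrand_bottom n hz).sub
    (tendsto_integral_poissonIntegrand_top n hz)).add (hright.const_mul I)).sub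
      (hleft.const_mul I)
  have hzero : ∀ᶠ R : ℝ in Filter.atTop,
      (∫ x in (-1 : ℝ)..1, f (x + (R⁻¹ : ℝ) * I)) - (∫ x in (-1 : ℝ)..1, f (x + R * I)) +
        I * (∫ s in R⁻¹..R, f (1 + s * I)) - I * (∫ s in R⁻¹..R, f (-1 + s * I)) = 0 := by
    filter_upwards [Filter.eventually_ge_atTop 1] with R hR
    have hR0 : 0 < R⁻¹ := by positivity
    have h := integral_boundary_rect_eq_zero_of_differentiableOn f
      (-1 + (R⁻¹ : ℝ) * I) (1 + R * I) fun t ht ↦ by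
        refine (differentiableAt_poissonIntegrand _ _
          (one_sub_sq_mem_slitPlane ?_)).differentiableWithinAt
        have him : t.im ∈ Set.uIcc R⁻¹ R := by simpa using (mem_reProdIm.1 ht).2
        rw [Set.uIcc_of_le ((inv_le_one_of_one_le₀ hR).trans hR)] at him
        exact hR0.trans_le him.1
    simpa using h
  have := tendsto_nhds_unique (hlim.congr' hzero) tendsto_const_nhds
  linear_combination this

theorem besselJPlus_contour_shift (n : ℕ) (z : ℝ) (hz : 0 < z) (ν ω : ℝ)
    (hν : ν = (n : ℝ) - 1 / 2) (hω : ω = z - Real.pi / 4 - n * Real.pi / 2) :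
    besselJPlus n (z : ℂ) =
      (((2 * Real.pi * z : ℝ) : ℂ) ^ (((-1 / 2 : ℝ)) : ℂ) / (Real.Gamma (ν + 1) : ℂ)) *
        ∫ u in Set.Ioi (0:ℝ),
          (Real.exp (-u) : ℂ) * (u : ℂ) ^ ((ν : ℝ) : ℂ) *
            (Complex.exp (-(Complex.I * (ω : ℂ))) *
                ((1 : ℂ) - Complex.I * (u : ℂ) / (2 * (z : ℂ))) ^ ((ν : ℝ) : ℂ) +
              Complex.exp (Complex.I * (ω : ℂ)) *
                ((1 : ℂ) + Complex.I * (u : ℂ) / (2 * (z : ℂ))) ^ ((ν : ℝ) : ℂ)) := by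
  have hright := integral_poissonIntegrand_vertical ν hz (.inl rfl)
  have hleft := integral_poissonIntegrand_vertical ν hz (.inr rfl)
  have hshift := integral_poissonIntegrand_eq n hz
  have hint : ∀ u : ℝ, (Real.exp (-u) : ℂ) * (u : ℂ) ^ ((ν : ℝ) : ℂ) *
      (Complex.exp (-(Complex.I * (ω : ℂ))) *
          ((1 : ℂ) - Complex.I * (u : ℂ) / (2 * (z : ℂ))) ^ ((ν : ℝ) : ℂ) +
        Complex.exp (Complex.I * (ω : ℂ)) *
          ((1 : ℂ) + Complex.I * (u : ℂ) / (2 * (z : ℂ))) ^ ((ν : ℝ) : ℂ)) =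
      Complex.exp (-(I * ω)) * laplaceIntegrand ν z (-1) u +
        Complex.exp (I * ω) * laplaceIntegrand ν z 1 u := by
    intro u
    have h : (1 + I * ((-1 : ℝ) : ℂ) * u / (2 * z) : ℂ) = 1 - I * u / (2 * z) := by
      push_cast; ring
    rw [laplaceIntegrand, laplaceIntegrand, h, ofReal_one, mul_one]
    ring
  have hexpl : I * Complex.exp (((-1 : ℝ) : ℂ) * I * (z - Real.pi * ν / 2)) =
      Complex.exp (-(I * ω)) := by
    nth_rw 1 [← exp_pi_div_two_mul_I]
    rw [← Complex.exp_add, hω, hν]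
    congr 1
    push_cast
    ring
  have hexpr : -I * Complex.exp (((1 : ℝ) : ℂ) * I * (z - Real.pi * ν / 2)) =
      Complex.exp (I * ω) := by
    nth_rw 1 [← exp_neg_pi_div_two_mul_I]
    rw [← Complex.exp_add, hω, hν]
    congr 1
    push_cast
    ring
  have hconst : (z / 2) ^ n / Real.Gamma (1 / 2) * ((2 / z) ^ ν * z⁻¹) =
      (2 * Real.pi * z) ^ (-1 / 2 : ℝ) := by
    have h2 : (0 : ℝ) < 2 / z := by positivity
    rw [hν, Real.rpow_sub h2, Real.rpow_natCast, ← Real.sqrt_eq_rpow, Real.Gamma_one_half_eq,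
      neg_div, Real.rpow_neg (by positivity), ← Real.sqrt_eq_rpow, Real.sqrt_div (by norm_num),
      Real.sqrt_mul (by positivity), Real.sqrt_mul (by norm_num)]
    have hs : √z ^ 2 = z := Real.sq_sqrt hz.le
    have hpz : 0 < √z := Real.sqrt_pos.2 hz
    have hpow : (z / 2) ^ n * (2 / z) ^ n = 1 := by
      rw [← mul_pow, show z / 2 * (2 / z) = 1 by field_simp, one_pow]
    have : 0 < √Real.pi := Real.sqrt_pos.2 Real.pi_pos
    calc _ = ((z / 2) ^ n * (2 / z) ^ n) * (√z / (√2 * √Real.pi * z)) := by field_simp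
      _ = _ := by rw [hpow]; nth_rw 2 [← hs]; field_simp
  have hconstC : ((z : ℂ) / 2) ^ n / (Real.Gamma (1 / 2) : ℂ) *
      (((2 / z : ℝ) : ℂ) ^ (ν : ℂ) * (z : ℂ)⁻¹) =
      ((2 * Real.pi * z : ℝ) : ℂ) ^ ((-1 / 2 : ℝ) : ℂ) := by
    rw [← ofReal_cpow (by positivity), ← ofReal_cpow (by positivity), ← hconst]
    push_cast
    ring
  have hJ : besselJPlus n z =
      ((z / 2 : ℂ) ^ n / ((Real.Gamma (ν + 1) : ℂ) * (Real.Gamma (1 / 2) : ℂ))) *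
        ∫ x in (-1 : ℝ)..1, poissonIntegrand ν z x := by
    rw [besselJPlus, show ν + 1 = n + 1 / 2 by rw [hν]; ring, hν]
    rfl
  have hl := (integrableOn_laplaceIntegrand n hz (.inr rfl)).const_mul (Complex.exp (-(I * ω)))
  have hr := (integrableOn_laplaceIntegrand n hz (.inl rfl)).const_mul (Complex.exp (I * ω))
  simp_rw [hint]
  rw [← hν] at hshift hl hr
  rw [MeasureTheory.integral_add hl hr, MeasureTheory.integral_const_mul,
    MeasureTheory.integral_const_mul, hJ, hshift, ← hexpl, ← hexpr, ← hconstC]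
  rw [ofReal_one] at hright
  rw [ofReal_neg, ofReal_one] at hleft
  rw [hright, hleft]
  push_cast
  ring
end

section
/- Let N ≥ 20 and let n be an integer with 0 ≤ n ≤ N. Let z ∈ ℂ satisfy |Re(z)| > 0.95 · N^{3/2} · ln(N) and |Im(z)| ≤ 1. Then |J_n^{++}(z)| ≤ 3.36 · |z|^{−1/2}, where J_n^{++}(z) := (2/(πz))^{1/2} · (e^{iω} / Γ(ν+1)) · ∫_0^∞ e^{−u} u^{ν} (1 + iu/(2z))^{ν} du, with ν := n − 1/2 and ω := z − π/4 − nπ/2. -/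
/-- A product of a Gamma weight with a power of a quadratic with nonnegative coefficients is
integrable, and its integral is at most the Gamma integral times the value of that power at any
point `M ≥ μ + 2n`. -/
lemma integral_gamma_weight_mul_quadratic_pow_le {a b : ℝ} (ha : 0 ≤ a) (hb : 0 ≤ b) (M : ℝ)
    (n : ℕ) : ∀ μ : ℝ, 0 < μ → μ + 2 * n ≤ M →
      MeasureTheory.IntegrableOn
        (fun u : ℝ => Real.exp (-u) * u ^ (μ - 1) * (1 + a * u + b * u ^ 2) ^ n) (Set.Ioi 0) ∧
      ∫ u in Set.Ioi (0 : ℝ), Real.exp (-u) * u ^ (μ - 1) * (1 + a * u + b * u ^ 2) ^ n ≤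
        Real.Gamma μ * (1 + a * M + b * M ^ 2) ^ n := by
  induction n with
  | zero =>
    intro μ hμ _
    simp only [pow_zero, mul_one]
    exact ⟨Real.GammaIntegral_convergent hμ, (Real.Gamma_eq_integral hμ).ge⟩
  | succ n ih =>
    intro μ hμ hM
    push_cast at hM
    have hn : (0 : ℝ) ≤ n := n.cast_nonneg
    obtain ⟨i0, h0⟩ := ih μ hμ (by linarith)
    obtain ⟨i1, h1⟩ := ih (μ + 1) (by linarith) (by linarith)
    obtain ⟨i2, h2⟩ := ih (μ + 2) (by linarith) (by linarith)
    have hcongr : Set.EqOn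
        (fun u : ℝ => Real.exp (-u) * u ^ (μ - 1) * (1 + a * u + b * u ^ 2) ^ n
          + a * (Real.exp (-u) * u ^ (μ + 1 - 1) * (1 + a * u + b * u ^ 2) ^ n)
          + b * (Real.exp (-u) * u ^ (μ + 2 - 1) * (1 + a * u + b * u ^ 2) ^ n))
        (fun u : ℝ => Real.exp (-u) * u ^ (μ - 1) * (1 + a * u + b * u ^ 2) ^ (n + 1))
        (Set.Ioi 0) := by
      intro u hu
      have hu : 0 < u := hu
      have e1 : u ^ (μ + 1 - 1) = u ^ (μ - 1) * u := by
        rw [show μ + 1 - 1 = (μ - 1) + 1 by ring, Real.rpow_add_one hu.ne']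
      have e2 : u ^ (μ + 2 - 1) = u ^ (μ - 1) * u ^ 2 := by
        rw [show μ + 2 - 1 = (μ - 1) + (2 : ℕ) by push_cast; ring, Real.rpow_add_natCast hu.ne']
      simp only [e1, e2]
      ring
    have i01 : MeasureTheory.IntegrableOn
        (fun u : ℝ => Real.exp (-u) * u ^ (μ - 1) * (1 + a * u + b * u ^ 2) ^ n
          + a * (Real.exp (-u) * u ^ (μ + 1 - 1) * (1 + a * u + b * u ^ 2) ^ n)) (Set.Ioi 0) :=
      i0.add (i1.const_mul a)
    have i012 := i01.add (i2.const_mul b)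
    refine ⟨MeasureTheory.IntegrableOn.congr_fun i012 hcongr measurableSet_Ioi, ?_⟩
    rw [← MeasureTheory.setIntegral_congr_fun measurableSet_Ioi hcongr,
      MeasureTheory.integral_add i01 (i2.const_mul b),
      MeasureTheory.integral_add i0 (i1.const_mul a),
      MeasureTheory.integral_const_mul, MeasureTheory.integral_const_mul]
    have hG : 0 < Real.Gamma μ := Real.Gamma_pos_of_pos hμ
    have g1 : Real.Gamma (μ + 1) = μ * Real.Gamma μ := Real.Gamma_add_one hμ.ne'
    have g2 : Real.Gamma (μ + 2) = (μ + 1) * (μ * Real.Gamma μ) := by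
      rw [show μ + 2 = (μ + 1) + 1 by ring, Real.Gamma_add_one (by linarith), g1]
    rw [g1] at h1
    rw [g2] at h2
    have hM0 : 0 ≤ M := by linarith
    have hQ : 0 ≤ (1 + a * M + b * M ^ 2) ^ n := by positivity
    have hq : 1 + a * μ + b * ((μ + 1) * μ) ≤ 1 + a * M + b * M ^ 2 := by
      have hp : (μ + 1) * μ ≤ M ^ 2 := by nlinarith
      have := mul_le_mul_of_nonneg_left hp hb
      have := mul_le_mul_of_nonneg_left (show μ ≤ M by linarith) ha
      linarith
    calc _ ≤ Real.Gamma μ * (1 + a * M + b * M ^ 2) ^ n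
          + a * (μ * Real.Gamma μ * (1 + a * M + b * M ^ 2) ^ n)
          + b * ((μ + 1) * (μ * Real.Gamma μ) * (1 + a * M + b * M ^ 2) ^ n) := by gcongr
      _ = Real.Gamma μ * (1 + a * M + b * M ^ 2) ^ n * (1 + a * μ + b * ((μ + 1) * μ)) := by ring
      _ ≤ Real.Gamma μ * (1 + a * M + b * M ^ 2) ^ n * (1 + a * M + b * M ^ 2) := by gcongr
      _ = _ := by ring

lemma norm_sq_one_add_I_mul_div {z : ℂ} (hz : z ≠ 0) (u : ℝ) :
    ‖(1 : ℂ) + Complex.I * (u : ℂ) / (2 * z)‖ ^ 2 =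
      1 + z.im * u / ‖z‖ ^ 2 + u ^ 2 / (4 * ‖z‖ ^ 2) := by
  have h : (1 : ℂ) + Complex.I * (u : ℂ) / (2 * z) = (2 * z + Complex.I * u) / (2 * z) := by
    field_simp
  have hR : ‖z‖ ^ 2 ≠ 0 := by simpa using hz
  have e1 : ‖2 * z + Complex.I * u‖ ^ 2 = 4 * ‖z‖ ^ 2 + 4 * z.im * u + u ^ 2 := by
    rw [← Complex.normSq_eq_norm_sq, ← Complex.normSq_eq_norm_sq, Complex.normSq_apply,
      Complex.normSq_apply]
    simp
    ring
  have e2 : ‖2 * z‖ ^ 2 = 4 * ‖z‖ ^ 2 := by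
    rw [norm_mul, mul_pow]
    norm_num
  rw [h, norm_div, div_pow, e1, e2]
  field_simp

/-- Lower bound for `‖z‖²` from the hypothesis on the real part. -/
lemma norm_sq_lower_bound {N : ℕ} (hN : 20 ≤ N) {z : ℂ}
    (hre : 0.95 * (N : ℝ) ^ ((3 : ℝ) / 2) * Real.log N < |z.re|) :
    6.9 * (N : ℝ) ^ 3 ≤ ‖z‖ ^ 2 := by
  have hN' : (20 : ℝ) ≤ N := by exact_mod_cast hN
  have hlog : 2.77 ≤ Real.log N := by
    have h16 : Real.log 16 ≤ Real.log N := Real.log_le_log (by norm_num) (by linarith)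
    have h2 : Real.log 16 = 4 * Real.log 2 := by
      rw [show (16 : ℝ) = 2 ^ 4 by norm_num, Real.log_pow]
      norm_num
    linarith [Real.log_two_gt_d9]
  have hsq : ((N : ℝ) ^ ((3 : ℝ) / 2)) ^ 2 = (N : ℝ) ^ 3 := by
    rw [← Real.rpow_natCast, ← Real.rpow_mul (by linarith), ← Real.rpow_natCast]
    norm_num
  have hp : 0 < (N : ℝ) ^ ((3 : ℝ) / 2) := by positivity
  have h1 : 0.95 * (N : ℝ) ^ ((3 : ℝ) / 2) * 2.77 ≤ ‖z‖ :=
    (mul_le_mul_of_nonneg_left hlog (by positivity)).trans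
      (hre.le.trans (Complex.abs_re_le_norm z))
  calc 6.9 * (N : ℝ) ^ 3 ≤ (0.95 * (N : ℝ) ^ ((3 : ℝ) / 2) * 2.77) ^ 2 := by
        rw [mul_pow, mul_pow, hsq]
        have : 0 < (N : ℝ) ^ 3 := by positivity
        linarith
    _ ≤ _ := by gcongr

/-- The integral in `besselJpp` is bounded by `1.49 Γ(ν + 1)`. -/
lemma norm_integral_besselJpp_le {N : ℕ} (hN : 20 ≤ N) {n : ℕ} (hn : n ≤ N) {z : ℂ}
    (hR : 6.9 * (N : ℝ) ^ 3 ≤ ‖z‖ ^ 2) (him : |z.im| ≤ 1) :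
    ‖∫ u in Set.Ioi (0:ℝ),
      (Real.exp (-u) : ℂ) * (u : ℂ) ^ ((((n : ℝ) - 1 / 2 : ℝ)) : ℂ) *
        ((1 : ℂ) + Complex.I * (u : ℂ) / (2 * z)) ^ ((((n : ℝ) - 1 / 2 : ℝ)) : ℂ)‖ ≤
      1.49 * Real.Gamma ((n : ℝ) - 1 / 2 + 1) := by
  have hN' : (20 : ℝ) ≤ N := by exact_mod_cast hN
  have hn' : (n : ℝ) ≤ N := by exact_mod_cast hn
  have hn0 : (0 : ℝ) ≤ n := n.cast_nonneg
  have hN3 : (20 : ℝ) ^ 3 ≤ (N : ℝ) ^ 3 := by gcongr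
  have hRpos : 0 < ‖z‖ ^ 2 := by linarith
  have hz : z ≠ 0 := by
    rintro rfl
    simp at hRpos
  obtain ⟨hy1, hy2⟩ := abs_le.mp him
  have hμ : (0 : ℝ) < (n : ℝ) - 1 / 2 + 1 := by linarith
  have hnorm : ∀ u ∈ Set.Ioi (0 : ℝ),
      ‖(Real.exp (-u) : ℂ) * (u : ℂ) ^ ((((n : ℝ) - 1 / 2 : ℝ)) : ℂ) *
        ((1 : ℂ) + Complex.I * (u : ℂ) / (2 * z)) ^ ((((n : ℝ) - 1 / 2 : ℝ)) : ℂ)‖ =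
      Real.exp (-u) * u ^ ((n : ℝ) - 1 / 2 + 1 - 1) *
        ‖(1 : ℂ) + Complex.I * (u : ℂ) / (2 * z)‖ ^ ((n : ℝ) - 1 / 2) := by
    intro u hu
    rw [norm_mul, norm_mul, Complex.norm_cpow_real, Complex.norm_cpow_real, Complex.norm_real,
      Complex.norm_real, Real.norm_of_nonneg (Real.exp_pos _).le,
      Real.norm_of_nonneg (le_of_lt hu), add_sub_cancel_right]
  have hG : 0 < Real.Gamma ((n : ℝ) - 1 / 2 + 1) := Real.Gamma_pos_of_pos hμ
  rcases Nat.eq_zero_or_pos n with h0 | hpos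
  · have hint : MeasureTheory.IntegrableOn
        (fun u : ℝ => 1.49 * (Real.exp (-u) * u ^ ((n : ℝ) - 1 / 2 + 1 - 1))) (Set.Ioi 0) :=
      (Real.GammaIntegral_convergent hμ).const_mul _
    refine (MeasureTheory.norm_integral_le_of_norm_le hint ?_).trans ?_
    · filter_upwards [MeasureTheory.ae_restrict_mem measurableSet_Ioi] with u hu
      rw [hnorm u hu, mul_comm (1.49 : ℝ)]
      have hu : 0 < u := hu
      gcongr
      have hsq := norm_sq_one_add_I_mul_div hz u
      set w := ‖(1 : ℂ) + Complex.I * (u : ℂ) / (2 * z)‖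
      have hw : 0.9 ^ 2 ≤ w ^ 2 := by
        have : 1 + z.im * u / ‖z‖ ^ 2 + u ^ 2 / (4 * ‖z‖ ^ 2) =
            (4 * ‖z‖ ^ 2 + 4 * z.im * u + u ^ 2) / (4 * ‖z‖ ^ 2) := by field_simp
        rw [hsq, this, le_div_iff₀ (by positivity)]
        nlinarith [sq_nonneg (u + 2 * z.im)]
      have hw' : 0.9 ≤ w := le_of_sq_le_sq hw (norm_nonneg _)
      calc w ^ ((n : ℝ) - 1 / 2) ≤ 0.9 ^ ((n : ℝ) - 1 / 2) :=
            Real.rpow_le_rpow_of_nonpos (by norm_num) hw' (by rw [h0]; norm_num)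
        _ ≤ 0.9 ^ (-1 : ℝ) :=
            Real.rpow_le_rpow_of_exponent_ge (by norm_num) (by norm_num) (by linarith)
        _ ≤ 1.49 := by rw [Real.rpow_neg_one]; norm_num
    · rw [MeasureTheory.integral_const_mul, ← Real.Gamma_eq_integral hμ]
  · have hn1 : (1 : ℝ) ≤ n := by exact_mod_cast hpos
    obtain ⟨hint, hle⟩ := integral_gamma_weight_mul_quadratic_pow_le (a := 1 / ‖z‖ ^ 2)
      (b := 1 / (4 * ‖z‖ ^ 2)) (by positivity) (by positivity) (3.025 * N) n _ hμ (by linarith)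
    refine (MeasureTheory.norm_integral_le_of_norm_le hint ?_).trans (hle.trans ?_)
    · filter_upwards [MeasureTheory.ae_restrict_mem measurableSet_Ioi] with u hu
      rw [hnorm u hu]
      have hu : 0 < u := hu
      gcongr
      have hsq := norm_sq_one_add_I_mul_div hz u
      set w := ‖(1 : ℂ) + Complex.I * (u : ℂ) / (2 * z)‖
      set q := 1 + 1 / ‖z‖ ^ 2 * u + 1 / (4 * ‖z‖ ^ 2) * u ^ 2 with hq
      have hq1 : 1 ≤ q := by
        have h1 : 0 ≤ 1 / ‖z‖ ^ 2 * u := by positivity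
        have h2 : 0 ≤ 1 / (4 * ‖z‖ ^ 2) * u ^ 2 := by positivity
        linarith
      have hwq2 : w ^ 2 ≤ q := by
        have h1 : z.im * u / ‖z‖ ^ 2 ≤ 1 * u / ‖z‖ ^ 2 := by gcongr
        rw [hsq, hq, div_mul_eq_mul_div, div_mul_eq_mul_div, one_mul, one_mul]
        rw [one_mul] at h1
        linarith
      have hw0 : 0 ≤ w := norm_nonneg _
      have hwq : w ≤ q := by nlinarith
      calc w ^ ((n : ℝ) - 1 / 2) ≤ q ^ ((n : ℝ) - 1 / 2) :=
            Real.rpow_le_rpow hw0 hwq (by linarith)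
        _ ≤ q ^ (n : ℝ) := Real.rpow_le_rpow_of_exponent_le hq1 (by linarith)
        _ = q ^ n := Real.rpow_natCast _ _
    · rw [mul_comm]
      gcongr
      have hx : 1 / ‖z‖ ^ 2 * (3.025 * N) + 1 / (4 * ‖z‖ ^ 2) * (3.025 * N) ^ 2 ≤ 0.36 / N := by
        have : 1 / ‖z‖ ^ 2 * (3.025 * N) + 1 / (4 * ‖z‖ ^ 2) * (3.025 * N) ^ 2 =
            (3.025 * N + (3.025 * N) ^ 2 / 4) / ‖z‖ ^ 2 := by field_simp
        rw [this, div_le_div_iff₀ hRpos (by linarith)]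
        nlinarith [mul_nonneg (sq_nonneg (N : ℝ)) (sub_nonneg.mpr hN')]
      calc (1 + 1 / ‖z‖ ^ 2 * (3.025 * N) + 1 / (4 * ‖z‖ ^ 2) * (3.025 * N) ^ 2) ^ n
          ≤ (Real.exp (0.36 / N)) ^ n := by
            gcongr
            linarith [Real.add_one_le_exp (0.36 / (N : ℝ))]
        _ ≤ (Real.exp (0.36 / N)) ^ N :=
            pow_le_pow_right₀ (Real.one_le_exp (by positivity)) hn
        _ = Real.exp 0.36 := by
            rw [← Real.exp_nat_mul]
            congr 1
            field_simp
        _ ≤ 1.49 := by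
            have h1 : (0.82 : ℝ) ≤ Real.exp (-0.18) := by
              linarith [Real.add_one_le_exp (-0.18 : ℝ)]
            have h2 : Real.exp 0.36 * (Real.exp (-0.18) * Real.exp (-0.18)) = 1 := by
              rw [← Real.exp_add, ← Real.exp_add]
              norm_num
            have h3 : 0.82 * 0.82 ≤ Real.exp (-0.18) * Real.exp (-0.18) := by gcongr
            nlinarith [Real.exp_pos 0.36]


open Complex Real

/-- `J_n^{++}(z) = (2/(πz))^{1/2} (e^{iω}/Γ(ν+1)) ∫_0^∞ e^{−u} u^ν (1+iu/(2z))^ν du`,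
where `ν = n − 1/2`, `ω = z − π/4 − nπ/2`, all complex powers principal branch. -/
noncomputable def besselJpp (n : ℕ) (z : ℂ) : ℂ :=
  (2 / ((Real.pi : ℂ) * z)) ^ ((1 / 2 : ℂ)) *
    (Complex.exp (Complex.I * (z - Real.pi / 4 - n * Real.pi / 2)) /
      (Real.Gamma ((n : ℝ) - 1 / 2 + 1) : ℂ)) *
    ∫ u in Set.Ioi (0:ℝ),
      (Real.exp (-u) : ℂ) * (u : ℂ) ^ ((((n : ℝ) - 1 / 2 : ℝ)) : ℂ) *
        ((1 : ℂ) + Complex.I * (u : ℂ) / (2 * z)) ^ ((((n : ℝ) - 1 / 2 : ℝ)) : ℂ)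

/-- For `N ≥ 20`, `0 ≤ n ≤ N`, and complex `z` with `|Re z| > 0.95 N^{3/2} ln N` and
`|Im z| ≤ 1`, one has `|J_n^{++}(z)| ≤ 3.36 |z|^{−1/2}`. -/
theorem besselJpp_bound (N : ℕ) (hN : 20 ≤ N) (n : ℕ) (hn : n ≤ N) (z : ℂ)
    (hre : 0.95 * (N : ℝ) ^ ((3 : ℝ) / 2) * Real.log N < |z.re|) (him : |z.im| ≤ 1) :
    ‖besselJpp n z‖ ≤ 3.36 * ‖z‖ ^ ((-1 / 2 : ℝ)) := by
  have hR := norm_sq_lower_bound hN hre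
  have hI := norm_integral_besselJpp_le hN hn hR him
  have hN' : (20 : ℝ) ≤ N := by exact_mod_cast hN
  have hN3 : (20 : ℝ) ^ 3 ≤ (N : ℝ) ^ 3 := by gcongr
  have hRpos : 0 < ‖z‖ := by
    by_contra h
    have : ‖z‖ = 0 := le_antisymm (not_lt.mp h) (norm_nonneg z)
    rw [this] at hR
    linarith
  have hG : 0 < Real.Gamma ((n : ℝ) - 1 / 2 + 1) :=
    Real.Gamma_pos_of_pos (by linarith [(n.cast_nonneg : (0 : ℝ) ≤ n)])
  have hpre : ‖(2 / ((Real.pi : ℂ) * z)) ^ ((1 / 2 : ℂ))‖ ≤ 0.8 * ‖z‖ ^ ((-1 / 2 : ℝ)) := by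
    rw [show (1 / 2 : ℂ) = ((1 / 2 : ℝ) : ℂ) by norm_num, Complex.norm_cpow_real, norm_div,
      norm_mul, Complex.norm_real, Real.norm_of_nonneg Real.pi_pos.le, Complex.norm_ofNat,
      show (-1 / 2 : ℝ) = -(1 / 2) by norm_num, Real.rpow_neg hRpos.le, ← div_div,
      Real.div_rpow (by positivity) hRpos.le, div_eq_mul_inv]
    gcongr
    rw [← Real.sqrt_eq_rpow, Real.sqrt_le_left (by norm_num), div_le_iff₀ Real.pi_pos]
    linarith [Real.pi_gt_d2]
  have hexp : ‖Complex.exp (Complex.I * (z - Real.pi / 4 - n * Real.pi / 2))‖ ≤ 2.72 := by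
    have hre' : (Complex.I * (z - Real.pi / 4 - n * Real.pi / 2)).re = -z.im := by
      rw [show Complex.I * (z - Real.pi / 4 - n * Real.pi / 2) =
        Complex.I * z - ((Real.pi / 4 + n * Real.pi / 2 : ℝ) : ℂ) * Complex.I by push_cast; ring]
      simp
    rw [Complex.norm_exp, hre']
    have : Real.exp (-z.im) ≤ Real.exp 1 := Real.exp_le_exp.mpr (by linarith [(abs_le.mp him).1])
    linarith [Real.exp_one_lt_d9]
  rw [besselJpp, norm_mul, norm_mul, norm_div, Complex.norm_real, Real.norm_of_nonneg hG.le]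
  generalize Real.Gamma ((n : ℝ) - 1 / 2 + 1) = G at hG hI ⊢
  calc _ ≤ (0.8 * ‖z‖ ^ ((-1 / 2 : ℝ))) * (2.72 / G) * (1.49 * G) := by gcongr
    _ = 0.8 * 2.72 * 1.49 * ‖z‖ ^ ((-1 / 2 : ℝ)) := by field_simp
    _ ≤ _ := by
      gcongr
      norm_num
end

section
/- Taylor expansion with remainder for complex powers: let ν be a real number and let x ≥ 0 be real. Then (1+ix)^ν = 1 + iνx − (1/2)ν(ν−1)x² − (i/6)ν(ν−1)(ν−2)x³ + r, where the remainder r satisfies |r| ≤ (1/24) · |ν(ν−1)(ν−2)(ν−3)| · x⁴ · (1+x²)^{max(ν−4, 0)/2}. -/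
open Complex

/-- If `f 0 = 0` and `‖f' t‖ ≤ C t ^ n` on `[0, x]`, then `‖f t‖ ≤ C t ^ (n + 1) / (n + 1)` there. -/
lemma norm_le_pow_succ_of_norm_deriv_le_pow {E : Type*} [NormedAddCommGroup E] [NormedSpace ℝ E]
    {f f' : ℝ → E} {x C : ℝ} {n : ℕ} (hf : ∀ t, HasDerivAt f (f' t) t) (h0 : f 0 = 0)
    (hf' : ∀ t ∈ Set.Icc 0 x, ‖f' t‖ ≤ C * t ^ n) :
    ∀ t ∈ Set.Icc 0 x, ‖f t‖ ≤ C / (n + 1) * t ^ (n + 1) := by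
  intro t ht
  have hn : (n : ℝ) + 1 ≠ 0 := by positivity
  refine image_norm_le_of_norm_deriv_right_le_deriv_boundary (f' := f')
    (B' := fun t => C * t ^ n)
    (fun s _ => (hf s).continuousAt.continuousWithinAt) (fun s _ => (hf s).hasDerivWithinAt)
    (B := fun t => C / (n + 1) * t ^ (n + 1)) (by simp [h0]) (fun s => ?_) (fun s hs => hf' s ⟨hs.1, hs.2.le⟩) ht
  refine ((hasDerivAt_pow (n + 1) s).const_mul (C / ((n : ℝ) + 1))).congr_deriv ?_
  rw [Nat.add_sub_cancel]
  push_cast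
  field_simp

/-- The degree `n` remainder of the binomial expansion of `(1 + I t) ^ ν`. -/
noncomputable def cpowRemainder (n : ℕ) (ν t : ℝ) : ℂ :=
  (1 + I * (t : ℂ)) ^ (ν : ℂ) -
    ∑ k ∈ Finset.range n,
      (∏ j ∈ Finset.range k, ((ν : ℂ) - j)) / (k.factorial : ℂ) * (I * (t : ℂ)) ^ k

lemma one_add_I_mul_mem_slitPlane (t : ℝ) : 1 + I * (t : ℂ) ∈ slitPlane := by
  left
  simp

lemma norm_one_add_I_mul_cpow (ν t : ℝ) :
    ‖(1 + I * (t : ℂ)) ^ (ν : ℂ)‖ = (1 + t ^ 2) ^ (ν / 2) := by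
  have hz := slitPlane_ne_zero (one_add_I_mul_mem_slitPlane t)
  have hnorm : ‖1 + I * (t : ℂ)‖ = √(1 + t ^ 2) := by
    rw [Complex.norm_def, normSq_apply]
    simp [pow_two]
  rw [norm_cpow_of_ne_zero hz, hnorm, Real.sqrt_eq_rpow, ← Real.rpow_mul (by positivity)]
  simp
  ring_nf

lemma prod_range_succ_sub (ν : ℂ) (k : ℕ) :
    ∏ j ∈ Finset.range (k + 1), (ν - j) = ν * ∏ j ∈ Finset.range k, (ν - 1 - j) := by
  rw [Finset.prod_range_succ', mul_comm]
  congr 1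
  · simp
  · refine Finset.prod_congr rfl fun j _ => ?_
    push_cast
    ring

lemma hasDerivAt_cpowRemainder (n : ℕ) (ν t : ℝ) :
    HasDerivAt (cpowRemainder (n + 1) ν) (I * ν * cpowRemainder n (ν - 1) t) t := by
  have hI : HasDerivAt (fun t : ℝ => I * (t : ℂ)) I t := by
    simpa using (hasDerivAt_id t).ofReal_comp.const_mul I
  have hc : HasDerivAt (fun t : ℝ => (1 + I * (t : ℂ)) ^ (ν : ℂ))
      (ν * (1 + I * (t : ℂ)) ^ ((ν : ℂ) - 1) * I) t :=
    (hasStrictDerivAt_cpow_const (one_add_I_mul_mem_slitPlane t)).hasDerivAt.comp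
      (h := fun t : ℝ => 1 + I * (t : ℂ)) (h₂ := fun z : ℂ => z ^ (ν : ℂ)) t (hI.const_add 1)
  have hs : HasDerivAt (fun t : ℝ => ∑ k ∈ Finset.range n,
      (∏ j ∈ Finset.range (k + 1), ((ν : ℂ) - j)) / ((k + 1).factorial : ℂ) *
        (I * (t : ℂ)) ^ (k + 1))
      (∑ k ∈ Finset.range n, I * ν * ((∏ j ∈ Finset.range k, ((ν : ℂ) - 1 - j)) /
        (k.factorial : ℂ) * (I * (t : ℂ)) ^ k)) t := by
    refine HasDerivAt.fun_sum fun k _ => ?_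
    refine ((hI.fun_pow (k + 1)).const_mul
      ((∏ j ∈ Finset.range (k + 1), ((ν : ℂ) - j)) / ((k + 1).factorial : ℂ))).congr_deriv ?_
    rw [prod_range_succ_sub, Nat.factorial_succ]
    have h1 : (k : ℂ) + 1 ≠ 0 := by exact_mod_cast k.succ_ne_zero
    have h2 : (k.factorial : ℂ) ≠ 0 := by exact_mod_cast k.factorial_ne_zero
    push_cast
    field_simp
  refine (((hc.fun_sub hs).sub_const 1).congr_deriv ?_).congr_of_eventuallyEq
    (.of_forall fun s => ?_)
  · rw [cpowRemainder, ← Finset.mul_sum]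
    push_cast
    ring
  · simp only [cpowRemainder, Finset.sum_range_succ' _ n]
    simp
    ring

lemma norm_cpowRemainder_le (n : ℕ) (ν x : ℝ) :
    ∀ t ∈ Set.Icc 0 x, ‖cpowRemainder n ν t‖ ≤
      ‖∏ j ∈ Finset.range n, ((ν : ℂ) - j)‖ / n.factorial *
        (1 + x ^ 2) ^ (max (ν - n) 0 / 2) * t ^ n := by
  induction n generalizing ν with
  | zero =>
    intro t ht
    have h1 : (1 + t ^ 2) ^ (ν / 2) ≤ (1 + t ^ 2) ^ (max ν 0 / 2) :=
      Real.rpow_le_rpow_of_exponent_le (by nlinarith [sq_nonneg t])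
        (by linarith [le_max_left ν 0])
    have h2 : (1 + t ^ 2) ^ (max ν 0 / 2) ≤ (1 + x ^ 2) ^ (max ν 0 / 2) :=
      Real.rpow_le_rpow (by positivity) (by nlinarith [ht.1, ht.2])
        (by linarith [le_max_right ν 0])
    simpa [cpowRemainder] using (norm_one_add_I_mul_cpow ν t).trans_le (h1.trans h2)
  | succ n ih =>
    intro t ht
    have h0 : cpowRemainder (n + 1) ν 0 = 0 := by
      simp [cpowRemainder, Finset.sum_range_succ']
    refine (norm_le_pow_succ_of_norm_deriv_le_pow
      (n := n) (C := ‖(ν : ℂ)‖ * (‖∏ j ∈ Finset.range n, ((ν : ℂ) - 1 - j)‖ / n.factorial *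
        (1 + x ^ 2) ^ (max (ν - 1 - n) 0 / 2)))
      (hasDerivAt_cpowRemainder n ν) h0 (fun s hs => ?_) t ht).trans_eq ?_
    · rw [norm_mul, norm_mul, norm_I, one_mul, mul_assoc]
      gcongr
      simpa using ih (ν - 1) s hs
    · rw [prod_range_succ_sub, norm_mul, Nat.factorial_succ,
        show ν - ((n + 1 : ℕ) : ℝ) = ν - 1 - n by push_cast; ring]
      push_cast
      field_simp


/-- Taylor expansion with remainder for principal-branch complex powers: for real `ν` and
real `x ≥ 0`, `(1+ix)^ν = 1 + iνx − (1/2)ν(ν−1)x² − (i/6)ν(ν−1)(ν−2)x³ + r` with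
`|r| ≤ (1/24)|ν(ν−1)(ν−2)(ν−3)| x⁴ (1+x²)^{max(ν−4,0)/2}`. -/
theorem cpow_taylor_expansion (ν : ℝ) (x : ℝ) (hx : 0 ≤ x) :
    ∃ r : ℂ,
      ((1 : ℂ) + Complex.I * (x : ℂ)) ^ ((ν : ℝ) : ℂ) =
        1 + Complex.I * ν * x - (1 / 2 : ℂ) * (ν * (ν - 1) * x ^ 2 : ℝ) -
          (Complex.I / 6) * (ν * (ν - 1) * (ν - 2) * x ^ 3 : ℝ) + r ∧
      ‖r‖ ≤ (1 / 24) * |ν * (ν - 1) * (ν - 2) * (ν - 3)| * x ^ 4 *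
        (1 + x ^ 2) ^ (max (ν - 4) 0 / 2) := by
  refine ⟨cpowRemainder 4 ν x, ?_, ?_⟩
  · simp only [cpowRemainder, Finset.sum_range_succ, Finset.prod_range_succ, Finset.sum_range_zero,
      Finset.prod_range_zero, Nat.factorial]
    push_cast
    ring_nf
    simp only [I_sq, I_pow_three]
    ring
  · have h := norm_cpowRemainder_le 4 ν x x ⟨hx, le_rfl⟩
    have hp : ∏ j ∈ Finset.range 4, ((ν : ℂ) - j) =
        ((ν * (ν - 1) * (ν - 2) * (ν - 3) : ℝ) : ℂ) := by
      simp [Finset.prod_range_succ]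
    rw [hp, norm_real, Real.norm_eq_abs] at h
    refine h.trans_eq ?_
    norm_num [Nat.factorial]
    ring
end

section
/- Fourth-order asymptotic expansion: let N ≥ 20, let n be an integer with 0 ≤ n ≤ N, and let z be real with z > 2 · N^{3/2} · ln(N). Set ν := n − 1/2 and ω := z − π/4 − nπ/2. Then | (πz/2)^{1/2} · J_n^{++}(z) · e^{−iω} − (1 + i·Γ(ν+2)/(2Γ(ν)z) − Γ(ν+3)/(8Γ(ν−1)z²) − i·Γ(ν+4)/(48Γ(ν−2)z³)) | ≤ 0.0043 · N⁸ / z⁴. -/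
open Complex Real

/-- Integrating a power bound on the derivative of a function vanishing at `0`. -/
lemma norm_le_of_norm_deriv_le_pow {f f' : ℝ → ℂ} {y C : ℝ} {k : ℕ}
    (hf : ∀ t, HasDerivAt f (f' t) t) (h0 : f 0 = 0)
    (hC : ∀ t ∈ Set.Icc 0 y, ‖f' t‖ ≤ C * t ^ k) :
    ∀ t ∈ Set.Icc 0 y, ‖f t‖ ≤ C / (k + 1) * t ^ (k + 1) := by
  intro t ht
  refine image_norm_le_of_norm_deriv_right_le_deriv_boundary (f' := f')
    (B := fun t => C / (k + 1) * t ^ (k + 1)) (B' := fun t => C * t ^ k)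
    (fun t _ => (hf t).continuousAt.continuousWithinAt)
    (fun t _ => (hf t).hasDerivWithinAt) (by simp [h0]) (fun t => ?_)
    (fun t ht => hC t ⟨ht.1, ht.2.le⟩) ht
  have h := (hasDerivAt_pow (k + 1) t).const_mul (C / (k + 1))
  have hk : (k : ℝ) + 1 ≠ 0 := by positivity
  refine h.congr_deriv ?_
  push_cast
  field_simp

lemma hasDerivAt_one_add_I_mul_cpow (c : ℂ) (t : ℝ) :
    HasDerivAt (fun t : ℝ => (1 + I * (t : ℂ)) ^ c)
      (I * (c * (1 + I * (t : ℂ)) ^ (c - 1))) t := by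
  have h1 : HasDerivAt (fun w : ℂ => 1 + I * w) I (t : ℂ) := by
    simpa using ((hasDerivAt_id (t : ℂ)).const_mul I).const_add 1
  have h2 : (1 + I * (t : ℂ)) ∈ slitPlane := by
    left; simp
  convert (h1.cpow_const (c := c) h2).comp_ofReal using 1
  ring

/-- Third-order Taylor expansion of `(1 + iy) ^ ν` at `y = 0`, with remainder. -/
lemma norm_one_add_I_mul_cpow_sub_le (ν : ℝ) {y B : ℝ} (hy : 0 ≤ y)
    (hB : ∀ t ∈ Set.Icc 0 y, ‖(1 + I * (t : ℂ)) ^ ((ν - 4 : ℝ) : ℂ)‖ ≤ B) :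
    ‖(1 + I * (y : ℂ)) ^ (ν : ℂ) - (1 + ν * (I * y) + ν * (ν - 1) / 2 * (I * y) ^ 2
        + ν * (ν - 1) * (ν - 2) / 6 * (I * y) ^ 3)‖
      ≤ |ν * (ν - 1) * (ν - 2) * (ν - 3)| / 24 * B * y ^ 4 := by
  have hlin (t : ℝ) : HasDerivAt (fun t : ℝ => I * (t : ℂ)) I t := by
    simpa using (hasDerivAt_id (t : ℂ)).comp_ofReal.const_mul I
  have e1 := norm_le_of_norm_deriv_le_pow (y := y) (k := 0) (C := |ν - 3| * B)
    (f := fun t : ℝ => (1 + I * (t : ℂ)) ^ ((ν : ℂ) - 3) - 1)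
    (f' := fun t => I * ((ν - 3 : ℝ) * (1 + I * (t : ℂ)) ^ ((ν - 4 : ℝ) : ℂ)))
    (fun t => by
      refine ((hasDerivAt_one_add_I_mul_cpow (ν - 3 : ℂ) t).sub_const 1).congr_deriv ?_
      push_cast
      rw [show (ν : ℂ) - 3 - 1 = ν - 4 by ring])
    (by simp)
    (fun t ht => by
      simp only [norm_mul, norm_I, one_mul, norm_real, Real.norm_eq_abs, pow_zero, mul_one]
      exact mul_le_mul_of_nonneg_left (hB t ht) (abs_nonneg _))
  have e2 := norm_le_of_norm_deriv_le_pow (y := y) (k := 1) (C := |ν - 2| * (|ν - 3| * B))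
    (f := fun t : ℝ => (1 + I * (t : ℂ)) ^ ((ν : ℂ) - 2) - (1 + (ν - 2) * (I * t)))
    (f' := fun t => I * ((ν - 2 : ℝ) * ((1 + I * (t : ℂ)) ^ ((ν : ℂ) - 3) - 1)))
    (fun t => by
      refine ((hasDerivAt_one_add_I_mul_cpow (ν - 2 : ℂ) t).sub
        (((hlin t).const_mul ((ν : ℂ) - 2)).const_add 1)).congr_deriv ?_
      push_cast
      rw [show (ν : ℂ) - 2 - 1 = ν - 3 by ring]
      ring)
    (by simp)
    (fun t ht => by
      simp only [norm_mul, norm_I, one_mul, norm_real, Real.norm_eq_abs]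
      rw [mul_assoc]
      refine mul_le_mul_of_nonneg_left ((e1 t ht).trans_eq ?_) (abs_nonneg _)
      norm_num)
  have e3 := norm_le_of_norm_deriv_le_pow (y := y) (k := 2)
    (C := |ν - 1| * (|ν - 2| * (|ν - 3| * B) / 2))
    (f := fun t : ℝ => (1 + I * (t : ℂ)) ^ ((ν : ℂ) - 1) -
      (1 + (ν - 1) * (I * t) + (ν - 1) * (ν - 2) / 2 * (I * t) ^ 2))
    (f' := fun t => I * ((ν - 1 : ℝ) *
      ((1 + I * (t : ℂ)) ^ ((ν : ℂ) - 2) - (1 + (ν - 2) * (I * t)))))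
    (fun t => by
      refine ((hasDerivAt_one_add_I_mul_cpow (ν - 1 : ℂ) t).sub
        ((((hlin t).const_mul ((ν : ℂ) - 1)).const_add 1).add
          (((hlin t).pow 2).const_mul (((ν : ℂ) - 1) * (ν - 2) / 2)))).congr_deriv ?_
      push_cast
      rw [show (ν : ℂ) - 1 - 1 = ν - 2 by ring]
      ring)
    (by simp)
    (fun t ht => by
      simp only [norm_mul, norm_I, one_mul, norm_real, Real.norm_eq_abs]
      rw [mul_assoc]
      refine mul_le_mul_of_nonneg_left ((e2 t ht).trans_eq ?_) (abs_nonneg _)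
      norm_num)
  have e4 := norm_le_of_norm_deriv_le_pow (y := y) (k := 3)
    (C := |ν| * (|ν - 1| * (|ν - 2| * (|ν - 3| * B) / 2) / 3))
    (f := fun t : ℝ => (1 + I * (t : ℂ)) ^ (ν : ℂ) -
      (1 + ν * (I * t) + ν * (ν - 1) / 2 * (I * t) ^ 2
        + ν * (ν - 1) * (ν - 2) / 6 * (I * t) ^ 3))
    (f' := fun t => I * ((ν : ℝ) * ((1 + I * (t : ℂ)) ^ ((ν : ℂ) - 1) -
      (1 + (ν - 1) * (I * t) + (ν - 1) * (ν - 2) / 2 * (I * t) ^ 2))))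
    (fun t => by
      refine ((hasDerivAt_one_add_I_mul_cpow (ν : ℂ) t).sub
        (((((hlin t).const_mul (ν : ℂ)).const_add 1).add
          (((hlin t).pow 2).const_mul ((ν : ℂ) * (ν - 1) / 2))).add
          (((hlin t).pow 3).const_mul ((ν : ℂ) * (ν - 1) * (ν - 2) / 6)))).congr_deriv ?_
      push_cast
      ring)
    (by simp)
    (fun t ht => by
      simp only [norm_mul, norm_I, one_mul, norm_real, Real.norm_eq_abs]
      rw [mul_assoc]
      refine mul_le_mul_of_nonneg_left ((e3 t ht).trans_eq ?_) (abs_nonneg _)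
      norm_num)
  refine (e4 y ⟨hy, le_rfl⟩).trans_eq ?_
  simp only [abs_mul]
  push_cast
  ring

lemma norm_one_add_I_mul_cpow_le {a t y : ℝ} {M : ℕ} (ha : a ≤ 2 * M) (ht : t ∈ Set.Icc 0 y) :
    ‖(1 + I * (t : ℂ)) ^ (a : ℂ)‖ ≤ (1 + y ^ 2) ^ M := by
  have hn : ‖1 + I * (t : ℂ)‖ ^ 2 = 1 + t ^ 2 := by
    rw [← Complex.normSq_eq_norm_sq, Complex.normSq_apply]
    simp
    ring
  have h1 : 1 ≤ ‖1 + I * (t : ℂ)‖ := by nlinarith [norm_nonneg (1 + I * (t : ℂ)), sq_nonneg t]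
  rw [Complex.norm_cpow_real]
  calc ‖1 + I * (t : ℂ)‖ ^ a ≤ ‖1 + I * (t : ℂ)‖ ^ ((2 * M : ℕ) : ℝ) :=
        Real.rpow_le_rpow_of_exponent_le h1 (by push_cast; exact ha)
    _ = (1 + t ^ 2) ^ M := by rw [Real.rpow_natCast, pow_mul, hn]
    _ ≤ (1 + y ^ 2) ^ M := by
        have := ht.1
        have := ht.2
        gcongr

lemma integrableOn_exp_neg_mul_rpow_mul_pow {ν : ℝ} (hν : -1 < ν) (k : ℕ) :
    MeasureTheory.IntegrableOn (fun u : ℝ => Real.exp (-u) * u ^ ν * u ^ k) (Set.Ioi 0) := by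
  refine (Real.GammaIntegral_convergent (s := ν + 1 + k) (by have := k.cast_nonneg (α := ℝ); linarith)).congr_fun
    (fun u hu => ?_) measurableSet_Ioi
  have hu : 0 < u := hu
  rw [mul_assoc, ← Real.rpow_natCast, ← Real.rpow_add hu]
  ring_nf

lemma integral_exp_neg_mul_rpow_mul_pow {ν : ℝ} (hν : -1 < ν) (k : ℕ) :
    ∫ u in Set.Ioi (0 : ℝ), Real.exp (-u) * u ^ ν * u ^ k = Real.Gamma (ν + 1 + k) := by
  rw [Real.Gamma_eq_integral (by have := k.cast_nonneg (α := ℝ); linarith)]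
  refine MeasureTheory.setIntegral_congr_fun measurableSet_Ioi (fun u hu => ?_)
  have hu : 0 < u := hu
  rw [mul_assoc, ← Real.rpow_natCast, ← Real.rpow_add hu]
  ring_nf

/-- Watson-type expansion of the Laplace integral of `u ^ ν (1 + isu) ^ ν`. -/
lemma norm_laplace_integral_sub_le {ν s : ℝ} (hν : -1 < ν) (hs : 0 ≤ s) {M : ℕ}
    (hM : ν - 4 ≤ 2 * M) :
    ‖(∫ u in Set.Ioi (0 : ℝ), ((Real.exp (-u) * u ^ ν : ℝ) : ℂ) *
          (1 + I * ((s * u : ℝ) : ℂ)) ^ (ν : ℂ))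
        - (Real.Gamma (ν + 1) + ν * (I * s) * Real.Gamma (ν + 2)
          + ν * (ν - 1) / 2 * (I * s) ^ 2 * Real.Gamma (ν + 3)
          + ν * (ν - 1) * (ν - 2) / 6 * (I * s) ^ 3 * Real.Gamma (ν + 4))‖
      ≤ |ν * (ν - 1) * (ν - 2) * (ν - 3)| / 24 * s ^ 4 *
          ∑ k ∈ Finset.range (M + 1), M.choose k * s ^ (2 * k) * Real.Gamma (ν + 5 + 2 * k) := by
  set w : ℝ → ℝ := fun u => Real.exp (-u) * u ^ ν
  set A : ℝ := |ν * (ν - 1) * (ν - 2) * (ν - 3)| / 24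
  have hint (k : ℕ) : MeasureTheory.IntegrableOn (fun u => w u * u ^ k) (Set.Ioi 0) :=
    integrableOn_exp_neg_mul_rpow_mul_pow hν k
  have hval (k : ℕ) : ∫ u in Set.Ioi (0 : ℝ), w u * u ^ k = Real.Gamma (ν + 1 + k) :=
    integral_exp_neg_mul_rpow_mul_pow hν k
  have hintC (k : ℕ) (c : ℂ) :
      MeasureTheory.IntegrableOn (fun u => c * ((w u * u ^ k : ℝ) : ℂ)) (Set.Ioi 0) :=
    (hint k).ofReal.const_mul c
  have hvalC (k : ℕ) (c : ℂ) : ∫ u in Set.Ioi (0 : ℝ), c * ((w u * u ^ k : ℝ) : ℂ)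
      = c * Real.Gamma (ν + 1 + k) := by
    rw [MeasureTheory.integral_const_mul, integral_complex_ofReal, hval]
  set P : ℝ → ℂ := fun u => 1 * ((w u * u ^ 0 : ℝ) : ℂ) + ν * (I * s) * ((w u * u ^ 1 : ℝ) : ℂ)
    + ν * (ν - 1) / 2 * (I * s) ^ 2 * ((w u * u ^ 2 : ℝ) : ℂ)
    + ν * (ν - 1) * (ν - 2) / 6 * (I * s) ^ 3 * ((w u * u ^ 3 : ℝ) : ℂ) with hP
  have hPint : MeasureTheory.IntegrableOn P (Set.Ioi 0) :=
    (((hintC 0 _).add (hintC 1 _)).add (hintC 2 _)).add (hintC 3 _)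
  have hPval : ∫ u in Set.Ioi (0 : ℝ), P u = Real.Gamma (ν + 1) + ν * (I * s) * Real.Gamma (ν + 2)
          + ν * (ν - 1) / 2 * (I * s) ^ 2 * Real.Gamma (ν + 3)
          + ν * (ν - 1) * (ν - 2) / 6 * (I * s) ^ 3 * Real.Gamma (ν + 4) := by
    refine (MeasureTheory.integral_add (((hintC 0 _).add (hintC 1 _)).add (hintC 2 _))
      (hintC 3 _)).trans ?_
    rw [MeasureTheory.integral_add' ((hintC 0 _).add (hintC 1 _)) (hintC 2 _),
      MeasureTheory.integral_add' (hintC 0 _) (hintC 1 _), hvalC, hvalC, hvalC, hvalC]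
    norm_num [add_assoc]
  set F : ℝ → ℂ := fun u => ((w u : ℝ) : ℂ) * (1 + I * ((s * u : ℝ) : ℂ)) ^ (ν : ℂ) with hF
  set D : ℝ → ℝ := fun u => A * s ^ 4 *
    ∑ k ∈ Finset.range (M + 1), M.choose k * s ^ (2 * k) * (w u * u ^ (4 + 2 * k)) with hD
  have hDint : MeasureTheory.IntegrableOn D (Set.Ioi 0) :=
    (MeasureTheory.integrable_finsetSum _ fun k _ => (hint _).const_mul _).const_mul _
  have hDval : ∫ u in Set.Ioi (0 : ℝ), D u = A * s ^ 4 *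
      ∑ k ∈ Finset.range (M + 1), M.choose k * s ^ (2 * k) * Real.Gamma (ν + 5 + 2 * k) := by
    rw [hD, MeasureTheory.integral_const_mul,
      MeasureTheory.integral_finsetSum _ fun k _ => (hint _).const_mul _]
    congr 1
    refine Finset.sum_congr rfl fun k _ => ?_
    rw [MeasureTheory.integral_const_mul, hval]
    congr 2
    push_cast
    ring
  have hbound : ∀ u ∈ Set.Ioi (0 : ℝ), ‖F u - P u‖ ≤ D u := by
    intro u hu
    have hu : 0 < u := hu
    have hw : 0 ≤ w u := by positivity
    have hr := norm_one_add_I_mul_cpow_sub_le ν (y := s * u) (B := (1 + (s * u) ^ 2) ^ M)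
      (by positivity) (fun t ht => norm_one_add_I_mul_cpow_le hM ht)
    have hFP : F u - P u = (w u : ℂ) * ((1 + I * ((s * u : ℝ) : ℂ)) ^ (ν : ℂ) -
        (1 + ν * (I * (s * u : ℝ)) + ν * (ν - 1) / 2 * (I * (s * u : ℝ)) ^ 2
        + ν * (ν - 1) * (ν - 2) / 6 * (I * (s * u : ℝ)) ^ 3)) := by
      simp only [hF, hP]
      push_cast
      ring
    rw [hFP, norm_mul, norm_real, Real.norm_of_nonneg hw]
    refine (mul_le_mul_of_nonneg_left hr hw).trans_eq ?_
    rw [add_comm (1 : ℝ), add_pow]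
    simp only [hD, Finset.mul_sum, Finset.sum_mul, one_pow, mul_one]
    refine Finset.sum_congr rfl fun k _ => ?_
    rw [pow_mul, pow_add, pow_mul u]
    ring
  have hFPmeas : MeasureTheory.AEStronglyMeasurable (fun u => F u - P u)
      (MeasureTheory.volume.restrict (Set.Ioi 0)) := by
    refine MeasureTheory.AEStronglyMeasurable.sub ?_ hPint.aestronglyMeasurable
    refine MeasureTheory.AEStronglyMeasurable.mul ?_ ?_
    · simpa using (hint 0).ofReal (𝕜 := ℂ) |>.aestronglyMeasurable
    · have : Continuous fun t : ℝ => (1 + I * (t : ℂ)) ^ (ν : ℂ) :=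
        continuous_iff_continuousAt.2 fun t => (hasDerivAt_one_add_I_mul_cpow ν t).continuousAt
      exact (this.comp (continuous_const.mul continuous_id)).aestronglyMeasurable
  have hFPint : MeasureTheory.IntegrableOn (fun u => F u - P u) (Set.Ioi 0) :=
    MeasureTheory.Integrable.mono' hDint hFPmeas
      ((MeasureTheory.ae_restrict_iff' measurableSet_Ioi).2 (Filter.Eventually.of_forall hbound))
  have hFint : MeasureTheory.IntegrableOn F (Set.Ioi 0) := by
    refine (hFPint.add hPint).congr_fun (fun u _ => ?_) measurableSet_Ioi
    simp
  rw [← hPval, ← MeasureTheory.integral_sub hFint hPint, ← hDval]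
  exact MeasureTheory.norm_integral_le_of_norm_le hDint
    ((MeasureTheory.ae_restrict_iff' measurableSet_Ioi).2 (Filter.Eventually.of_forall hbound))

lemma Gamma_add_natCast_le {a b : ℝ} (ha : 0 < a) {j : ℕ} (hb : a + j ≤ b) :
    Real.Gamma (a + j) ≤ b ^ j * Real.Gamma a := by
  induction j with
  | zero => simp
  | succ j ih =>
    push_cast at hb ⊢
    have hj : 0 < a + j := by positivity
    rw [← add_assoc, Real.Gamma_add_one hj.ne', pow_succ', mul_assoc]
    exact mul_le_mul (by linarith) (ih (by linarith)) (Real.Gamma_pos_of_pos hj).le (by linarith)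

/-- A binomial sum of Gamma values is dominated by an exponential. -/
lemma sum_choose_mul_Gamma_le {a b s : ℝ} (ha : 0 < a) {M : ℕ} (hb : a + 2 * M ≤ b) :
    ∑ k ∈ Finset.range (M + 1), M.choose k * s ^ (2 * k) * Real.Gamma (a + 2 * k)
      ≤ Real.exp (M * (b * s) ^ 2) * Real.Gamma a := by
  have hG := Real.Gamma_pos_of_pos ha
  calc ∑ k ∈ Finset.range (M + 1), M.choose k * s ^ (2 * k) * Real.Gamma (a + 2 * k)
      ≤ ∑ k ∈ Finset.range (M + 1), M.choose k * s ^ (2 * k) * (b ^ (2 * k) * Real.Gamma a) := by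
        refine Finset.sum_le_sum fun k hk => ?_
        have hk : (k : ℝ) ≤ M := by exact_mod_cast Nat.lt_succ_iff.1 (Finset.mem_range.1 hk)
        have h := Gamma_add_natCast_le (j := 2 * k) ha (b := b) (by push_cast; linarith)
        push_cast at h
        refine mul_le_mul_of_nonneg_left h ?_
        rw [pow_mul]
        positivity
    _ = ((b * s) ^ 2 + 1) ^ M * Real.Gamma a := by
        rw [add_pow, Finset.sum_mul]
        refine Finset.sum_congr rfl fun k _ => ?_
        rw [pow_mul, pow_mul, mul_pow, mul_pow]
        ring
    _ ≤ Real.exp (M * (b * s) ^ 2) * Real.Gamma a := by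
        rw [Real.exp_nat_mul]
        have := Real.add_one_le_exp ((b * s) ^ 2)
        gcongr

lemma sqrt_mul_two_div_cpow_half {z : ℝ} (hz : 0 < z) :
    (Real.sqrt (Real.pi * z / 2) : ℂ) * (2 / ((Real.pi : ℂ) * z)) ^ (1 / 2 : ℂ) = 1 := by
  have hx : 0 < Real.pi * z / 2 := by positivity
  have h : (2 / ((Real.pi : ℂ) * z)) ^ (1 / 2 : ℂ) = ((Real.sqrt (Real.pi * z / 2))⁻¹ : ℝ) := by
    rw [← Real.sqrt_inv, Real.sqrt_eq_rpow, Complex.ofReal_cpow (by positivity)]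
    congr 1
    · push_cast
      rw [inv_div]
    · norm_num
  rw [h, ← Complex.ofReal_mul, mul_inv_cancel₀ (Real.sqrt_pos.2 hx).ne', Complex.ofReal_one]

/-- The Bessel factor with its prefactor and oscillation removed, as a Laplace integral. -/
lemma sqrt_mul_besselJpp_mul_exp (n : ℕ) {z : ℝ} (hz : 0 < z) {ν ω : ℝ}
    (hν : ν = (n : ℝ) - 1 / 2) (hω : ω = z - Real.pi / 4 - n * Real.pi / 2) :
    (Real.sqrt (Real.pi * z / 2) : ℂ) * besselJpp n (z : ℂ) * Complex.exp (-(I * (ω : ℂ)))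
      = (∫ u in Set.Ioi (0 : ℝ), ((Real.exp (-u) * u ^ ν : ℝ) : ℂ) *
          (1 + I * ((1 / (2 * z) * u : ℝ) : ℂ)) ^ (ν : ℂ)) / Real.Gamma (ν + 1) := by
  have hint : (∫ u in Set.Ioi (0:ℝ),
      (Real.exp (-u) : ℂ) * (u : ℂ) ^ ((((n : ℝ) - 1 / 2 : ℝ)) : ℂ) *
        ((1 : ℂ) + I * (u : ℂ) / (2 * z)) ^ ((((n : ℝ) - 1 / 2 : ℝ)) : ℂ))
      = ∫ u in Set.Ioi (0 : ℝ), ((Real.exp (-u) * u ^ ν : ℝ) : ℂ) *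
          (1 + I * ((1 / (2 * z) * u : ℝ) : ℂ)) ^ (ν : ℂ) := by
    refine MeasureTheory.setIntegral_congr_fun measurableSet_Ioi fun u hu => ?_
    have hu : 0 < u := hu
    rw [← hν, Complex.ofReal_mul, Complex.ofReal_cpow hu.le]
    congr 3
    push_cast
    ring
  have hexp : Complex.exp (I * (z - Real.pi / 4 - n * Real.pi / 2)) *
      Complex.exp (-(I * (ω : ℂ))) = 1 := by
    rw [← Complex.exp_add, hω]
    push_cast
    simp
  rw [besselJpp, hint, ← hν]
  set J := ∫ u in Set.Ioi (0 : ℝ), ((Real.exp (-u) * u ^ ν : ℝ) : ℂ) *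
          (1 + I * ((1 / (2 * z) * u : ℝ) : ℂ)) ^ (ν : ℂ)
  linear_combination (J / Real.Gamma (ν + 1)) *
    (Complex.exp (I * (z - Real.pi / 4 - n * Real.pi / 2)) *
      Complex.exp (-(I * (ω : ℂ))) * sqrt_mul_two_div_cpow_half hz + hexp)

lemma abs_prod_sq_sub_le {N n : ℕ} (hN : 4 ≤ N) (hn : n ≤ N) {ν : ℝ} (hν : ν = (n : ℝ) - 1 / 2) :
    |ν * (ν - 1) * (ν - 2) * (ν - 3)| * |(ν + 1) * (ν + 2) * (ν + 3) * (ν + 4)|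
      ≤ (N : ℝ) ^ 8 := by
  have hN : (4 : ℝ) ≤ N := by exact_mod_cast hN
  have hn : (n : ℝ) ≤ N := by exact_mod_cast hn
  have hn0 : (0 : ℝ) ≤ n := n.cast_nonneg
  have key (c : ℝ) (h0 : 0 ≤ c) (h1 : c ≤ 16) : |(n : ℝ) ^ 2 - c| ≤ (N : ℝ) ^ 2 := by
    rw [abs_le]
    constructor <;> nlinarith
  calc |ν * (ν - 1) * (ν - 2) * (ν - 3)| * |(ν + 1) * (ν + 2) * (ν + 3) * (ν + 4)|
      = |(n : ℝ) ^ 2 - 1 / 4| * |(n : ℝ) ^ 2 - 9 / 4| * |(n : ℝ) ^ 2 - 25 / 4| *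
          |(n : ℝ) ^ 2 - 49 / 4| := by
        simp only [← abs_mul, hν]
        congr 1
        ring
    _ ≤ (N : ℝ) ^ 2 * (N : ℝ) ^ 2 * (N : ℝ) ^ 2 * (N : ℝ) ^ 2 := by
        gcongr <;> exact key _ (by norm_num) (by norm_num)
    _ = (N : ℝ) ^ 8 := by ring

lemma four_mul_pow_three_le_sq {N : ℕ} (hN : 20 ≤ N) {z : ℝ}
    (hz : 2 * (N : ℝ) ^ ((3 : ℝ) / 2) * Real.log N < z) : 0 < z ∧ 4 * (N : ℝ) ^ 3 ≤ z ^ 2 := by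
  have hN : (20 : ℝ) ≤ N := by exact_mod_cast hN
  have hlog : 1 ≤ Real.log N := by
    rw [Real.le_log_iff_exp_le (by linarith)]
    linarith [Real.exp_one_lt_d9]
  have hp : 0 < (N : ℝ) ^ ((3 : ℝ) / 2) := by positivity
  have hsq : ((N : ℝ) ^ ((3 : ℝ) / 2)) ^ 2 = (N : ℝ) ^ 3 := by
    rw [← Real.rpow_natCast, ← Real.rpow_mul (by linarith), ← Real.rpow_natCast]
    norm_num
  have hle : 2 * (N : ℝ) ^ ((3 : ℝ) / 2) ≤ z := by nlinarith
  refine ⟨by linarith, ?_⟩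
  rw [← hsq]
  nlinarith

/-- Fourth-order asymptotic expansion: for `N ≥ 20`, `0 ≤ n ≤ N`, and real
`z > 2 N^{3/2} ln N`, with `ν = n − 1/2` and `ω = z − π/4 − nπ/2`,
`(πz/2)^{1/2} J_n^{++}(z) e^{−iω}` equals
`1 + iΓ(ν+2)/(2Γ(ν)z) − Γ(ν+3)/(8Γ(ν−1)z²) − iΓ(ν+4)/(48Γ(ν−2)z³)` up to an error of
at most `0.0043 N⁸/z⁴`. -/
theorem besselJpp_asymptotic (N : ℕ) (hN : 20 ≤ N) (n : ℕ) (hn : n ≤ N) (z : ℝ)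
    (hz : 2 * (N : ℝ) ^ ((3 : ℝ) / 2) * Real.log N < z) (ν ω : ℝ)
    (hν : ν = (n : ℝ) - 1 / 2) (hω : ω = z - Real.pi / 4 - n * Real.pi / 2) :
    ‖(Real.sqrt (Real.pi * z / 2) : ℂ) * besselJpp n (z : ℂ) *
          Complex.exp (-(Complex.I * (ω : ℂ))) -
        (1 + Complex.I * ((Real.Gamma (ν + 2) / (2 * Real.Gamma ν * z) : ℝ) : ℂ) -
          ((Real.Gamma (ν + 3) / (8 * Real.Gamma (ν - 1) * z ^ 2) : ℝ) : ℂ) -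
          Complex.I * ((Real.Gamma (ν + 4) / (48 * Real.Gamma (ν - 2) * z ^ 3) : ℝ) : ℂ))‖ ≤
      0.0043 * (N : ℝ) ^ 8 / z ^ 4 := by
  obtain ⟨hz0, hz2⟩ := four_mul_pow_three_le_sq hN hz
  have hn0 : (0 : ℝ) ≤ n := n.cast_nonneg
  have hν1 : -1 < ν := by linarith
  have hG : 0 < Real.Gamma (ν + 1) := Real.Gamma_pos_of_pos (by linarith)
  have hne (m : ℤ) : ν - m ≠ 0 := by
    intro h
    have h2 : (2 * n - 1 : ℤ) = 2 * m := by
      have : (2 * n - 1 : ℝ) = 2 * m := by linarith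
      exact_mod_cast this
    omega
  have hne0 : ν ≠ 0 := by simpa using hne 0
  have hne1 : ν - 1 ≠ 0 := by simpa using hne 1
  have hne2 : ν - 2 ≠ 0 := by simpa using hne 2
  have g1 : Real.Gamma (ν + 1) = ν * Real.Gamma ν := Real.Gamma_add_one hne0
  have g2 : Real.Gamma ν = (ν - 1) * Real.Gamma (ν - 1) := by
    simpa using Real.Gamma_add_one hne1
  have g3 : Real.Gamma (ν - 1) = (ν - 2) * Real.Gamma (ν - 2) := by
    convert Real.Gamma_add_one hne2 using 2
    ring
  have hG2 : Real.Gamma (ν - 2) ≠ 0 := by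
    intro h
    simp [g1, g2, g3, h] at hG
  have hM : ν - 4 ≤ 2 * (n / 2 : ℕ) := by
    have : (n : ℝ) ≤ 2 * (n / 2 : ℕ) + 1 := by exact_mod_cast (by omega : n ≤ 2 * (n / 2) + 1)
    linarith
  have hM' : ((n / 2 : ℕ) : ℝ) ≤ N / 2 := by
    have : 2 * ((n / 2 : ℕ) : ℝ) ≤ N := by exact_mod_cast (by omega : 2 * (n / 2) ≤ N)
    linarith
  have hNr : (20 : ℝ) ≤ N := by exact_mod_cast hN
  have hnr : (n : ℝ) ≤ N := by exact_mod_cast hn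
  have hs : 0 ≤ 1 / (2 * z) := by positivity
  have hmain := norm_laplace_integral_sub_le hν1 hs hM
  have hsum := sum_choose_mul_Gamma_le (a := ν + 5) (b := 3 * N) (s := 1 / (2 * z))
    (M := n / 2) (by linarith) (by linarith)
  have hexp : Real.exp ((n / 2 : ℕ) * (3 * N * (1 / (2 * z))) ^ 2) ≤ 1.65 := by
    have hx : ((n / 2 : ℕ) : ℝ) * (3 * N * (1 / (2 * z))) ^ 2 ≤ 9 / 32 := by
      calc ((n / 2 : ℕ) : ℝ) * (3 * N * (1 / (2 * z))) ^ 2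
          ≤ N / 2 * (3 * N * (1 / (2 * z))) ^ 2 := by gcongr
        _ = 9 * N ^ 3 / (8 * z ^ 2) := by
          field_simp
          ring
        _ ≤ 9 / 32 := by
          rw [div_le_div_iff₀ (by positivity) (by norm_num)]
          linarith
    have h1 := Real.add_one_le_exp (-(9 / 32 : ℝ))
    rw [Real.exp_neg] at h1
    refine (Real.exp_le_exp.2 hx).trans ?_
    rw [← inv_inv (Real.exp (9 / 32))]
    refine (inv_anti₀ (by norm_num) h1).trans ?_
    norm_num
  have g5 : Real.Gamma (ν + 5) =
      |(ν + 1) * (ν + 2) * (ν + 3) * (ν + 4)| * Real.Gamma (ν + 1) := by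
    have h (c : ℝ) (hc : 1 ≤ c) : Real.Gamma (ν + (c + 1)) = (ν + c) * Real.Gamma (ν + c) := by
      rw [← add_assoc]
      exact Real.Gamma_add_one (by linarith)
    have h1 := h 1 (by norm_num)
    have h2 := h 2 (by norm_num)
    have h3 := h 3 (by norm_num)
    have h4 := h 4 (by norm_num)
    norm_num at h1 h2 h3 h4
    have p1 : 0 < ν + 1 := by linarith
    have p2 : 0 < ν + 2 := by linarith
    have p3 : 0 < ν + 3 := by linarith
    have p4 : 0 < ν + 4 := by linarith
    rw [abs_of_pos (by positivity), h4, h3, h2, h1]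
    ring
  have hprod := abs_prod_sq_sub_le (by omega) hn hν
  set G := Real.Gamma (ν + 1)
  have hexpand : (1 + I * ((Real.Gamma (ν + 2) / (2 * Real.Gamma ν * z) : ℝ) : ℂ) -
          ((Real.Gamma (ν + 3) / (8 * Real.Gamma (ν - 1) * z ^ 2) : ℝ) : ℂ) -
          I * ((Real.Gamma (ν + 4) / (48 * Real.Gamma (ν - 2) * z ^ 3) : ℝ) : ℂ)) =
      (G + ν * (I * (1 / (2 * z) : ℝ)) * Real.Gamma (ν + 2)
          + ν * (ν - 1) / 2 * (I * (1 / (2 * z) : ℝ)) ^ 2 * Real.Gamma (ν + 3)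
          + ν * (ν - 1) * (ν - 2) / 6 * (I * (1 / (2 * z) : ℝ)) ^ 3 * Real.Gamma (ν + 4)) / G := by
    have c0 : (ν : ℂ) ≠ 0 := by exact_mod_cast hne0
    have c1 : (ν : ℂ) - 1 ≠ 0 := by exact_mod_cast hne1
    have c2 : (ν : ℂ) - 2 ≠ 0 := by exact_mod_cast hne2
    have cz : (z : ℂ) ≠ 0 := by exact_mod_cast hz0.ne'
    have cG : (Real.Gamma (ν - 2) : ℂ) ≠ 0 := by exact_mod_cast hG2
    rw [mul_pow, mul_pow, I_sq, I_pow_three, g1, g2, g3]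
    push_cast
    field_simp
    ring
  rw [sqrt_mul_besselJpp_mul_exp n hz0 hν hω, hexpand, ← sub_div, norm_div, norm_real,
    Real.norm_of_nonneg hG.le, div_le_iff₀ hG]
  refine hmain.trans ?_
  calc _ ≤ |ν * (ν - 1) * (ν - 2) * (ν - 3)| / 24 * (1 / (2 * z)) ^ 4 *
        (1.65 * Real.Gamma (ν + 5)) := by
        refine mul_le_mul_of_nonneg_left (hsum.trans ?_) (by positivity)
        exact mul_le_mul_of_nonneg_right hexp (Real.Gamma_pos_of_pos (by linarith)).le
    _ = |ν * (ν - 1) * (ν - 2) * (ν - 3)| * |(ν + 1) * (ν + 2) * (ν + 3) * (ν + 4)| *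
        (1.65 / 384 / z ^ 4 * G) := by
        rw [g5]
        field_simp
        ring
    _ ≤ (N : ℝ) ^ 8 * (1.65 / 384 / z ^ 4 * G) := by gcongr
    _ ≤ (N : ℝ) ^ 8 * (0.0043 / z ^ 4 * G) := by
        gcongr
        norm_num
    _ = 0.0043 * (N : ℝ) ^ 8 / z ^ 4 * G := by ring
end
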